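/- arXiv:2305.07267 — 4 statements merged into one kernel-verified Lean document; each statement's English description precedes it below -/
import Mathlib

section
/- Let c₁ ∈ ℝ and let u : ℝ × ℝ → ℝ be a C^∞ function that is 2π-periodic in its second (space) variable and satisfies the fifth-order modified KdV equation ∂_t u − ∂_x⁵ u + c₁ u ∂_x u ∂_x² u + (c₁/4) u² ∂_x³ u + (c₁/4)(∂_x u)³ − (3c₁²/160) u⁴ ∂_x u = 0 everywhere. Then the three Hamiltonians ℋ₀[u](t) = ∫_0^{2π} (1/2) u(t,x)² dx, ℋ₁[u](t) = ∫_0^{2π} [(1/2)(∂_x u)² + (c₁/80) u⁴](t,x) dx, and ℋ₂[u](t) = ∫_0^{2π} [(1/2)(∂_x² u)² + (c₁/8) u² (∂_x u)² + (c₁²/1600) u⁶](t,x) dx are each constant in t. -/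
noncomputable section
namespace MKdV5

open Function intervalIntegral

/-- The partial derivative of `f` in its first (time) variable. -/
def partialTime (f : ℝ → ℝ → ℝ) (t x : ℝ) : ℝ := deriv (fun s => f s x) t

/-- The partial derivative of `f` in its second (space) variable. -/
def partialSpace (f : ℝ → ℝ → ℝ) (t x : ℝ) : ℝ := deriv (f t) x

section PartialDerivatives

variable {f : ℝ → ℝ → ℝ}

lemma hasDerivAt_fst_fderiv (hf : ContDiff ℝ (⊤ : ℕ∞) (uncurry f)) (t x : ℝ) :
    HasDerivAt (fun s => f s x) (fderiv ℝ (uncurry f) (t, x) (1, 0)) t := by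
  have h : HasFDerivAt (uncurry f) (fderiv ℝ (uncurry f) (t, x)) (t, x) :=
    (hf.differentiable (by simp)).differentiableAt.hasFDerivAt
  exact h.comp_hasDerivAt t ((hasDerivAt_id t).prodMk (hasDerivAt_const t x))

lemma hasDerivAt_snd_fderiv (hf : ContDiff ℝ (⊤ : ℕ∞) (uncurry f)) (t x : ℝ) :
    HasDerivAt (f t) (fderiv ℝ (uncurry f) (t, x) (0, 1)) x := by
  have h : HasFDerivAt (uncurry f) (fderiv ℝ (uncurry f) (t, x)) (t, x) :=
    (hf.differentiable (by simp)).differentiableAt.hasFDerivAt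
  exact h.comp_hasDerivAt x ((hasDerivAt_const x t).prodMk (hasDerivAt_id x))

lemma uncurry_partialTime (hf : ContDiff ℝ (⊤ : ℕ∞) (uncurry f)) :
    uncurry (partialTime f) = fun p => fderiv ℝ (uncurry f) p (1, 0) :=
  funext fun p => (hasDerivAt_fst_fderiv hf p.1 p.2).deriv

lemma uncurry_partialSpace (hf : ContDiff ℝ (⊤ : ℕ∞) (uncurry f)) :
    uncurry (partialSpace f) = fun p => fderiv ℝ (uncurry f) p (0, 1) :=
  funext fun p => (hasDerivAt_snd_fderiv hf p.1 p.2).deriv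

lemma contDiff_fderiv_uncurry (hf : ContDiff ℝ (⊤ : ℕ∞) (uncurry f)) :
    ContDiff ℝ (⊤ : ℕ∞) (fderiv ℝ (uncurry f)) :=
  hf.fderiv_right (by simp)

lemma contDiff_partialTime (hf : ContDiff ℝ (⊤ : ℕ∞) (uncurry f)) :
    ContDiff ℝ (⊤ : ℕ∞) (uncurry (partialTime f)) := by
  rw [uncurry_partialTime hf]
  exact (contDiff_fderiv_uncurry hf).clm_apply contDiff_const

lemma contDiff_partialSpace (hf : ContDiff ℝ (⊤ : ℕ∞) (uncurry f)) :
    ContDiff ℝ (⊤ : ℕ∞) (uncurry (partialSpace f)) := by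
  rw [uncurry_partialSpace hf]
  exact (contDiff_fderiv_uncurry hf).clm_apply contDiff_const

lemma hasDerivAt_partialTime (hf : ContDiff ℝ (⊤ : ℕ∞) (uncurry f)) (t x : ℝ) :
    HasDerivAt (fun s => f s x) (partialTime f t x) t :=
  (hasDerivAt_fst_fderiv hf t x).differentiableAt.hasDerivAt

lemma hasDerivAt_partialSpace (hf : ContDiff ℝ (⊤ : ℕ∞) (uncurry f)) (t x : ℝ) :
    HasDerivAt (f t) (partialSpace f t x) x :=
  (hasDerivAt_snd_fderiv hf t x).differentiableAt.hasDerivAt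

lemma partialTime_partialSpace_comm (hf : ContDiff ℝ (⊤ : ℕ∞) (uncurry f)) :
    partialTime (partialSpace f) = partialSpace (partialTime f) := by
  funext t x
  have hD : HasFDerivAt (fderiv ℝ (uncurry f)) (fderiv ℝ (fderiv ℝ (uncurry f)) (t, x)) (t, x) :=
    ((contDiff_fderiv_uncurry hf).differentiable (by simp)).differentiableAt.hasFDerivAt
  have hsymm : IsSymmSndFDerivAt ℝ (uncurry f) (t, x) :=
    hf.contDiffAt.isSymmSndFDerivAt
      (by
        rw [minSmoothness_of_isRCLikeNormedField]
        exact WithTop.coe_le_coe.2 (le_top (a := (2 : ℕ∞))))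
  have htime := hasDerivAt_fst_fderiv (contDiff_partialSpace hf) t x
  have hspace := hasDerivAt_snd_fderiv (contDiff_partialTime hf) t x
  rw [uncurry_partialSpace hf, (hD.clm_apply (hasFDerivAt_const _ _)).fderiv] at htime
  rw [uncurry_partialTime hf, (hD.clm_apply (hasFDerivAt_const _ _)).fderiv] at hspace
  rw [partialTime, partialSpace, htime.deriv, hspace.deriv]
  simpa using hsymm (1, 0) (0, 1)

lemma partialSpace_iterate (k : ℕ) (t x : ℝ) :
    partialSpace^[k] f t x = iteratedDeriv k (f t) x := by
  induction k generalizing x with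
  | zero => simp
  | succ k ih =>
    rw [iterate_succ_apply', iteratedDeriv_succ, partialSpace]
    exact congrArg (deriv · x) (funext ih)

lemma partialSpace_periodic {T : ℝ} (hper : ∀ t x, f t (x + T) = f t x) (t x : ℝ) :
    partialSpace f t (x + T) = partialSpace f t x := by
  rw [partialSpace, partialSpace, ← deriv_comp_add_const]
  exact congrArg (deriv · x) (funext (hper t))

lemma partialTime_periodic {T : ℝ} (hper : ∀ t x, f t (x + T) = f t x) (t x : ℝ) :
    partialTime f t (x + T) = partialTime f t x := by
  simp only [partialTime, hper]

end PartialDerivatives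

/-- A density whose time derivative is the space derivative of a `T`-periodic flux has a
conserved integral over `[0, T]`. -/
lemma integral_eq_of_conservation_law {T : ℝ} {h g F : ℝ → ℝ → ℝ}
    (hcont : Continuous (uncurry h)) (gcont : Continuous (uncurry g))
    (htime : ∀ t x, HasDerivAt (fun s => h s x) (g t x) t)
    (hspace : ∀ t x, HasDerivAt (F t) (g t x) x)
    (hper : ∀ t x, F t (x + T) = F t x) (t t' : ℝ) :
    ∫ x in (0 : ℝ)..T, h t x = ∫ x in (0 : ℝ)..T, h t' x := by
  have hslice : ∀ s, Continuous (h s) := fun s => hcont.comp (Continuous.prodMk_right s)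
  have gslice : ∀ s, Continuous (g s) := fun s => gcont.comp (Continuous.prodMk_right s)
  have hderiv : ∀ s, HasDerivAt (fun s => ∫ x in (0 : ℝ)..T, h s x) 0 s := by
    intro s
    obtain ⟨C, hC⟩ := ((isCompact_closedBall s 1).prod
      (isCompact_uIcc (a := 0) (b := T))).exists_bound_of_continuousOn gcont.continuousOn
    have key := (hasDerivAt_integral_of_dominated_loc_of_deriv_le
      (μ := MeasureTheory.volume) (a := 0) (b := T) (bound := fun _ => C)
      (F := h) (F' := g) (x₀ := s) (Metric.closedBall_mem_nhds s one_pos)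
      (.of_forall fun r => (hslice r).aestronglyMeasurable)
      ((hslice s).intervalIntegrable 0 T) (gslice s).aestronglyMeasurable
      (.of_forall fun x hx r hr => hC (r, x) ⟨hr, Set.uIoc_subset_uIcc hx⟩)
      intervalIntegrable_const
      (.of_forall fun x _ r _ => htime r x)).2
    rw [integral_eq_sub_of_hasDerivAt (fun x _ => hspace s x)
      ((gslice s).intervalIntegrable 0 T)] at key
    have hzero : F s T = F s 0 := by simpa using hper s 0
    rwa [hzero, sub_self] at key
  exact is_const_of_deriv_eq_zero (fun s => (hderiv s).differentiableAt)
    (fun s => (hderiv s).deriv) t t'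

/-- **Conservation of the Hamiltonians `ℋ₀`, `ℋ₁`, `ℋ₂`** for classical smooth
`2π`-periodic solutions of the fifth-order mKdV equation with the coefficient constraint. -/
theorem hamiltonians_conserved (c₁ : ℝ) (u : ℝ → ℝ → ℝ)
    (hsmooth : ContDiff ℝ (⊤ : ℕ∞) (Function.uncurry u))
    (hper : ∀ t x : ℝ, u t (x + 2 * Real.pi) = u t x)
    (heq : ∀ t x : ℝ,
      deriv (fun t' => u t' x) t - iteratedDeriv 5 (u t) x +
          c₁ * u t x * deriv (u t) x * iteratedDeriv 2 (u t) x +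
          c₁ / 4 * (u t x) ^ 2 * iteratedDeriv 3 (u t) x +
          c₁ / 4 * (deriv (u t) x) ^ 3 -
          3 * c₁ ^ 2 / 160 * (u t x) ^ 4 * deriv (u t) x = 0) :
    (∀ t t' : ℝ,
      (∫ x in (0:ℝ)..(2 * Real.pi), 1 / 2 * (u t x) ^ 2) =
        ∫ x in (0:ℝ)..(2 * Real.pi), 1 / 2 * (u t' x) ^ 2) ∧
    (∀ t t' : ℝ,
      (∫ x in (0:ℝ)..(2 * Real.pi),
          (1 / 2 * (deriv (u t) x) ^ 2 + c₁ / 80 * (u t x) ^ 4)) =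
        ∫ x in (0:ℝ)..(2 * Real.pi),
          (1 / 2 * (deriv (u t') x) ^ 2 + c₁ / 80 * (u t' x) ^ 4)) ∧
    (∀ t t' : ℝ,
      (∫ x in (0:ℝ)..(2 * Real.pi),
          (1 / 2 * (iteratedDeriv 2 (u t) x) ^ 2 +
            c₁ / 8 * (u t x) ^ 2 * (deriv (u t) x) ^ 2 +
            c₁ ^ 2 / 1600 * (u t x) ^ 6)) =
        ∫ x in (0:ℝ)..(2 * Real.pi),
          (1 / 2 * (iteratedDeriv 2 (u t') x) ^ 2 +
            c₁ / 8 * (u t' x) ^ 2 * (deriv (u t') x) ^ 2 +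
            c₁ ^ 2 / 1600 * (u t' x) ^ 6)) := by
  have h5 : ∀ t x, iteratedDeriv 5 (u t) x = partialSpace^[5] u t x :=
    fun t x => (partialSpace_iterate 5 t x).symm
  have h3 : ∀ t x, iteratedDeriv 3 (u t) x = partialSpace^[3] u t x :=
    fun t x => (partialSpace_iterate 3 t x).symm
  have h2 : ∀ t x, iteratedDeriv 2 (u t) x = partialSpace^[2] u t x :=
    fun t x => (partialSpace_iterate 2 t x).symm
  have h1 : ∀ t x, deriv (u t) x = partialSpace u t x := fun _ _ => rfl
  have h0 : ∀ t x, deriv (fun s => u s x) t = partialTime u t x := fun _ _ => rfl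
  simp only [h0, h1, h2, h3, h5, iterate_succ, iterate_zero, comp_apply, id] at heq ⊢
  have su1 := contDiff_partialSpace hsmooth
  have su2 := contDiff_partialSpace su1
  have su3 := contDiff_partialSpace su2
  have su4 := contDiff_partialSpace su3
  have sq := contDiff_partialTime hsmooth
  have sq1 := contDiff_partialSpace sq
  have sq2 := contDiff_partialSpace sq1
  have dt0 := hasDerivAt_partialTime hsmooth
  have dt1 := hasDerivAt_partialTime su1
  have dt2 := hasDerivAt_partialTime su2
  rw [partialTime_partialSpace_comm su1] at dt2
  rw [partialTime_partialSpace_comm hsmooth] at dt1 dt2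
  have d0 := hasDerivAt_partialSpace hsmooth
  have d1 := hasDerivAt_partialSpace su1
  have d2 := hasDerivAt_partialSpace su2
  have d3 := hasDerivAt_partialSpace su3
  have d4 := hasDerivAt_partialSpace su4
  have dq := hasDerivAt_partialSpace sq
  have dq1 := hasDerivAt_partialSpace sq1
  have p1 := partialSpace_periodic hper
  have p2 := partialSpace_periodic p1
  have p3 := partialSpace_periodic p2
  have p4 := partialSpace_periodic p3
  have pq := partialTime_periodic hper
  have pq1 := partialSpace_periodic pq
  replace hsmooth := hsmooth.continuous
  replace su1 := su1.continuous
  replace su2 := su2.continuous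
  replace su3 := su3.continuous
  replace su4 := su4.continuous
  replace sq := sq.continuous
  replace sq1 := sq1.continuous
  replace sq2 := sq2.continuous
  generalize partialSpace (partialSpace (partialTime u)) = q2 at *
  generalize partialSpace (partialTime u) = q1 at *
  generalize partialTime u = q at *
  generalize partialSpace (partialSpace (partialSpace (partialSpace (partialSpace u)))) = u5 at *
  generalize partialSpace (partialSpace (partialSpace (partialSpace u))) = u4 at *
  generalize partialSpace (partialSpace (partialSpace u)) = u3 at *
  generalize partialSpace (partialSpace u) = u2 at *
  generalize partialSpace u = u1 at *
  -- The variational derivative `E` of the third Hamiltonian, whose space derivative is `∂ₜu`.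
  obtain ⟨E, hE⟩ : ∃ E : ℝ → ℝ → ℝ, ∀ t x, E t x = u4 t x - c₁ / 4 * (u t x * u1 t x ^ 2) -
      c₁ / 4 * (u t x ^ 2 * u2 t x) + 3 * c₁ ^ 2 / 800 * u t x ^ 5 := ⟨_, fun _ _ => rfl⟩
  have pE : ∀ t x, E t (x + 2 * Real.pi) = E t x := by
    intro t x
    simp only [hE, hper, p1, p2, p4]
  have dE : ∀ t x, HasDerivAt (E t) (q t x) x := by
    intro t x
    rw [show E t = _ from funext (hE t)]
    refine (((d4 t x).sub (((d0 t x).mul ((d1 t x).pow 2)).const_mul (c₁ / 4))).sub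
      ((((d0 t x).pow 2).mul (d2 t x)).const_mul (c₁ / 4))).add
      (((d0 t x).pow 5).const_mul (3 * c₁ ^ 2 / 800)) |>.congr_deriv ?_
    simp only [Pi.pow_apply, Nat.cast_ofNat, Nat.reduceSub]
    linear_combination -heq t x
  refine ⟨?_, ?_, ?_⟩
  · refine integral_eq_of_conservation_law (g := fun t x => u t x * q t x)
      (F := fun t x => u t x * E t x - u1 t x * u3 t x + 1 / 2 * u2 t x ^ 2 +
        c₁ / 8 * (u t x ^ 2 * u1 t x ^ 2) - c₁ ^ 2 / 1600 * u t x ^ 6) ?_ ?_ ?_ ?_ ?_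
    · fun_prop
    · fun_prop
    · intro t x
      refine (((dt0 t x).pow 2).const_mul (1 / 2)).congr_deriv ?_
      simp only [Nat.cast_ofNat, Nat.reduceSub]
      ring
    · intro t x
      refine (((((d0 t x).mul (dE t x)).sub ((d1 t x).mul (d3 t x))).add
        (((d2 t x).pow 2).const_mul (1 / 2))).add
        ((((d0 t x).pow 2).mul ((d1 t x).pow 2)).const_mul (c₁ / 8))).sub
        (((d0 t x).pow 6).const_mul (c₁ ^ 2 / 1600)) |>.congr_deriv ?_
      simp only [Pi.pow_apply, Nat.cast_ofNat, Nat.reduceSub]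
      rw [hE]
      ring
    · intro t x
      simp only [hper, p1, p2, p3, pE]
  · refine integral_eq_of_conservation_law
      (g := fun t x => u1 t x * q1 t x + c₁ / 20 * u t x ^ 3 * q t x)
      (F := fun t x => u1 t x * q t x + (c₁ / 20 * u t x ^ 3 - u2 t x) * E t x +
        1 / 2 * u3 t x ^ 2 - 3 * c₁ / 20 * (u t x ^ 2 * (u1 t x * u3 t x)) -
        c₁ / 20 * (u t x ^ 2 * u2 t x ^ 2) + c₁ / 20 * (u t x * (u1 t x ^ 2 * u2 t x)) -
        c₁ / 80 * u1 t x ^ 4 + 3 * c₁ ^ 2 / 800 * (u t x ^ 5 * u2 t x) +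
        3 * c₁ ^ 2 / 320 * (u t x ^ 4 * u1 t x ^ 2) -
        9 * c₁ ^ 3 / 128000 * u t x ^ 8) ?_ ?_ ?_ ?_ ?_
    · fun_prop
    · fun_prop
    · intro t x
      refine (((dt1 t x).pow 2).const_mul (1 / 2)).add
        (((dt0 t x).pow 4).const_mul (c₁ / 80)) |>.congr_deriv ?_
      simp only [Nat.cast_ofNat, Nat.reduceSub]
      ring
    · intro t x
      refine ((((((((((d1 t x).mul (dq t x)).add
        (((((d0 t x).pow 3).const_mul (c₁ / 20)).sub (d2 t x)).mul (dE t x))).add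
        (((d3 t x).pow 2).const_mul (1 / 2))).sub
        ((((d0 t x).pow 2).mul ((d1 t x).mul (d3 t x))).const_mul (3 * c₁ / 20))).sub
        ((((d0 t x).pow 2).mul ((d2 t x).pow 2)).const_mul (c₁ / 20))).add
        (((d0 t x).mul (((d1 t x).pow 2).mul (d2 t x))).const_mul (c₁ / 20))).sub
        (((d1 t x).pow 4).const_mul (c₁ / 80))).add
        ((((d0 t x).pow 5).mul (d2 t x)).const_mul (3 * c₁ ^ 2 / 800))).add
        ((((d0 t x).pow 4).mul ((d1 t x).pow 2)).const_mul (3 * c₁ ^ 2 / 320))).sub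
        (((d0 t x).pow 8).const_mul (9 * c₁ ^ 3 / 128000)) |>.congr_deriv ?_
      simp only [Pi.pow_apply, Pi.mul_apply, Pi.sub_apply, Nat.cast_ofNat, Nat.reduceSub]
      rw [hE]
      ring
    · intro t x
      simp only [hper, p1, p2, p3, pE, pq]
  · refine integral_eq_of_conservation_law
      (g := fun t x => u2 t x * q2 t x + c₁ / 4 * (u t x * u1 t x ^ 2 * q t x +
        u t x ^ 2 * u1 t x * q1 t x) + 3 * c₁ ^ 2 / 800 * u t x ^ 5 * q t x)
      (F := fun t x => u2 t x * q1 t x - u3 t x * q t x +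
        c₁ / 4 * (u t x ^ 2 * (u1 t x * q t x)) + 1 / 2 * E t x ^ 2) ?_ ?_ ?_ ?_ ?_
    · fun_prop
    · fun_prop
    · intro t x
      refine ((((dt2 t x).pow 2).const_mul (1 / 2)).add
        ((((dt0 t x).pow 2).const_mul (c₁ / 8)).mul ((dt1 t x).pow 2))).add
        (((dt0 t x).pow 6).const_mul (c₁ ^ 2 / 1600)) |>.congr_deriv ?_
      simp only [Pi.pow_apply, Nat.cast_ofNat, Nat.reduceSub]
      ring
    · intro t x
      refine ((((d2 t x).mul (dq1 t x)).sub ((d3 t x).mul (dq t x))).add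
        ((((d0 t x).pow 2).mul ((d1 t x).mul (dq t x))).const_mul (c₁ / 4))).add
        (((dE t x).pow 2).const_mul (1 / 2)) |>.congr_deriv ?_
      simp only [Pi.pow_apply, Pi.mul_apply, Nat.cast_ofNat, Nat.reduceSub]
      rw [hE]
      ring
    · intro t x
      simp only [hper, p1, p2, p3, pE, pq, pq1]

end MKdV5
end
end

section
/- Let c₁ ∈ ℝ. (i) For every C^∞ function u : ℝ → ℝ that is 2π-periodic, the following identity of functions holds: ∂_x⁵u − c₁ u ∂_x u ∂_x²u − (c₁/4) u² ∂_x³u − (c₁/4)(∂_x u)³ + (3c₁²/160) u⁴ ∂_x u = ∂_x( ∂_x⁴u − (c₁/4)( u(∂_x u)² + u² ∂_x²u ) + (3c₁²/800) u⁵ ). (ii) The bracketed expression is the L² gradient of ℋ₂: for all C^∞ 2π-periodic u, v : ℝ → ℝ, (d/dε) ℋ₂[u + εv] |_{ε=0} = ∫_0^{2π} ( ∂_x⁴u − (c₁/4)( u(∂_x u)² + u² ∂_x²u ) + (3c₁²/800) u⁵ )(x) v(x) dx. Consequently the fifth-order mKdV equation with coefficient constraint can be written as the Hamiltonian system u_t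 = ∂_x ∇_u ℋ₂[u]. -/
noncomputable section
namespace MKdV5

/-- Differentiation under the integral sign over a compact interval, for an integrand whose
partial derivative in the parameter is jointly continuous. -/
theorem hasDerivAt_intervalIntegral_of_continuous_deriv {F F' : ℝ → ℝ → ℝ} (a b t₀ : ℝ)
    (hF : ∀ t, Continuous (F t)) (hF' : Continuous fun p : ℝ × ℝ => F' p.1 p.2)
    (hFF' : ∀ t x, HasDerivAt (fun s => F s x) (F' t x) t) :
    HasDerivAt (fun t => ∫ x in a..b, F t x) (∫ x in a..b, F' t₀ x) t₀ := by
  obtain ⟨C, hC⟩ := ((isCompact_closedBall t₀ 1).prod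
    (isCompact_uIcc (a := a) (b := b))).exists_bound_of_continuousOn hF'.continuousOn
  have hF't₀ : Continuous (F' t₀) := hF'.comp (by fun_prop : Continuous fun x : ℝ => (t₀, x))
  refine (intervalIntegral.hasDerivAt_integral_of_dominated_loc_of_deriv_le
    (bound := fun _ => C) (Metric.closedBall_mem_nhds t₀ one_pos)
    (Filter.Eventually.of_forall fun t => (hF t).aestronglyMeasurable)
    ((hF t₀).intervalIntegrable _ _) hF't₀.aestronglyMeasurable
    (Filter.Eventually.of_forall fun x hx t ht => ?_) intervalIntegrable_const
    (Filter.Eventually.of_forall fun x _ t _ => hFF' t x)).2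
  exact hC (t, x) ⟨ht, Set.uIoc_subset_uIcc hx⟩

theorem hasDerivAt_iteratedDeriv {u : ℝ → ℝ} (hu : ContDiff ℝ (⊤ : ℕ∞) u) (n : ℕ) (x : ℝ) :
    HasDerivAt (iteratedDeriv n u) (iteratedDeriv (n + 1) u x) x := by
  rw [iteratedDeriv_succ]
  exact (hu.differentiable_iteratedDeriv n (by exact_mod_cast ENat.natCast_lt_top n) x).hasDerivAt

theorem iteratedDeriv_periodic {u : ℝ → ℝ} {T : ℝ} (hu : Function.Periodic u T) (n : ℕ) :
    Function.Periodic (iteratedDeriv n u) T := fun x => by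
  have h := congrFun (iteratedDeriv_comp_add_const (n := n) (f := u) (s := T)) x
  rw [← h, hu.funext]

theorem iteratedDeriv_add_const_mul {u v : ℝ → ℝ} (hu : ContDiff ℝ (⊤ : ℕ∞) u)
    (hv : ContDiff ℝ (⊤ : ℕ∞) v) (n : ℕ) (ε x : ℝ) :
    iteratedDeriv n (fun y => u y + ε * v y) x =
      iteratedDeriv n u x + ε * iteratedDeriv n v x := by
  have hn : (n : WithTop ℕ∞) ≤ ((⊤ : ℕ∞) : WithTop ℕ∞) := by exact_mod_cast le_top
  have h := iteratedDeriv_add (n := n) (x := x) (hu.of_le hn).contDiffAt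
    ((contDiff_const (c := ε)).mul (hv.of_le hn)).contDiffAt
  rw [iteratedDeriv_const_mul_field] at h
  exact h

/-- **The fifth-order mKdV equation with the coefficient constraint is the Hamiltonian flow
of `ℋ₂`**: (i) the spatial part of the equation is in divergence form,
`∂ₓ⁵u - c₁u∂ₓu∂ₓ²u - (c₁/4)u²∂ₓ³u - (c₁/4)(∂ₓu)³ + (3c₁²/160)u⁴∂ₓu
  = ∂ₓ(∂ₓ⁴u - (c₁/4)(u(∂ₓu)² + u²∂ₓ²u) + (3c₁²/800)u⁵)`,
and (ii) the bracketed expression is the `L²` gradient of `ℋ₂`. -/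
theorem hamiltonian_form_H2 (c₁ : ℝ) :
    (∀ u : ℝ → ℝ, ContDiff ℝ (⊤ : ℕ∞) u → (∀ x : ℝ, u (x + 2 * Real.pi) = u x) →
      ∀ x : ℝ,
        iteratedDeriv 5 u x - c₁ * u x * deriv u x * iteratedDeriv 2 u x -
            c₁ / 4 * (u x) ^ 2 * iteratedDeriv 3 u x - c₁ / 4 * (deriv u x) ^ 3 +
            3 * c₁ ^ 2 / 160 * (u x) ^ 4 * deriv u x =
          deriv (fun y =>
            iteratedDeriv 4 u y -
              c₁ / 4 * (u y * (deriv u y) ^ 2 + (u y) ^ 2 * iteratedDeriv 2 u y) +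
              3 * c₁ ^ 2 / 800 * (u y) ^ 5) x) ∧
    (∀ u v : ℝ → ℝ, ContDiff ℝ (⊤ : ℕ∞) u → (∀ x : ℝ, u (x + 2 * Real.pi) = u x) →
      ContDiff ℝ (⊤ : ℕ∞) v → (∀ x : ℝ, v (x + 2 * Real.pi) = v x) →
      HasDerivAt
        (fun ε : ℝ => ∫ x in (0:ℝ)..(2 * Real.pi),
          (1 / 2 * (iteratedDeriv 2 (fun y => u y + ε * v y) x) ^ 2 +
            c₁ / 8 * (u x + ε * v x) ^ 2 * (deriv (fun y => u y + ε * v y) x) ^ 2 +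
            c₁ ^ 2 / 1600 * (u x + ε * v x) ^ 6))
        (∫ x in (0:ℝ)..(2 * Real.pi),
          (iteratedDeriv 4 u x -
              c₁ / 4 * (u x * (deriv u x) ^ 2 + (u x) ^ 2 * iteratedDeriv 2 u x) +
              3 * c₁ ^ 2 / 800 * (u x) ^ 5) * v x)
        0) := by
  refine ⟨fun u hu _ x => ?_, fun u v hu hup hv hvp => ?_⟩
  · have h0 := hasDerivAt_iteratedDeriv hu 0 x
    have h1 := hasDerivAt_iteratedDeriv hu 1 x
    have h2 := hasDerivAt_iteratedDeriv hu 2 x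
    have h4 := hasDerivAt_iteratedDeriv hu 4 x
    simp only [iteratedDeriv_zero, zero_add, Nat.reduceAdd] at h0 h1 h2 h4
    rw [← iteratedDeriv_one]
    refine (((h4.sub (((h0.mul (h1.pow 2)).add ((h0.pow 2).mul h2)).const_mul (c₁ / 4))).add
      ((h0.pow 5).const_mul (3 * c₁ ^ 2 / 800))).deriv.trans ?_).symm
    simp only [Pi.pow_apply]
    push_cast
    ring
  · have hcu (n : ℕ) : Continuous (iteratedDeriv n u) :=
      continuous_iff_continuousAt.2 fun x => (hasDerivAt_iteratedDeriv hu n x).continuousAt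
    have hcv (n : ℕ) : Continuous (iteratedDeriv n v) :=
      continuous_iff_continuousAt.2 fun x => (hasDerivAt_iteratedDeriv hv n x).continuousAt
    have hu0 := hu.continuous
    have hv0 := hv.continuous
    have hu1 := hcu 1
    have hu2 := hcu 2
    have hu3 := hcu 3
    have hu4 := hcu 4
    have hv1 := hcv 1
    have hv2 := hcv 2
    simp only [← iteratedDeriv_one, iteratedDeriv_add_const_mul hu hv]
    have key := hasDerivAt_intervalIntegral_of_continuous_deriv
      (F := fun ε x =>
        1 / 2 * (iteratedDeriv 2 u x + ε * iteratedDeriv 2 v x) ^ 2 +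
          c₁ / 8 * (u x + ε * v x) ^ 2 * (iteratedDeriv 1 u x + ε * iteratedDeriv 1 v x) ^ 2 +
          c₁ ^ 2 / 1600 * (u x + ε * v x) ^ 6)
      (F' := fun ε x =>
        (iteratedDeriv 2 u x + ε * iteratedDeriv 2 v x) * iteratedDeriv 2 v x +
          c₁ / 4 * ((u x + ε * v x) * v x * (iteratedDeriv 1 u x + ε * iteratedDeriv 1 v x) ^ 2 +
            (u x + ε * v x) ^ 2 * (iteratedDeriv 1 u x + ε * iteratedDeriv 1 v x) *
              iteratedDeriv 1 v x) +
          3 * c₁ ^ 2 / 800 * (u x + ε * v x) ^ 5 * v x)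
      0 (2 * Real.pi) 0 (fun ε => by fun_prop) (by fun_prop) (fun ε x => by
        have hlin (a b : ℝ) : HasDerivAt (fun s : ℝ => a + s * b) b ε := by
          simpa using ((hasDerivAt_id ε).mul_const b).const_add a
        refine ((((hlin _ _).pow 2).const_mul (1 / 2)).add
          ((((hlin _ _).pow 2).const_mul (c₁ / 8)).mul ((hlin _ _).pow 2))).add
          (((hlin _ _).pow 6).const_mul (c₁ ^ 2 / 1600)) |>.congr_deriv ?_
        simp only [Pi.pow_apply]
        push_cast
        ring)
    refine key.congr_deriv (sub_eq_zero.1 ?_)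
    rw [← intervalIntegral.integral_sub (Continuous.intervalIntegrable (by fun_prop) _ _)
      (Continuous.intervalIntegrable (by fun_prop) _ _)]
    rw [intervalIntegral.integral_eq_sub_of_hasDerivAt
      (f := fun x => iteratedDeriv 2 u x * iteratedDeriv 1 v x - iteratedDeriv 3 u x * v x +
        c₁ / 4 * (u x ^ 2 * iteratedDeriv 1 u x * v x)) (fun x _ => ?_)
      (Continuous.intervalIntegrable (by fun_prop) _ _)]
    · have hu_per (n : ℕ) := (iteratedDeriv_periodic hup n).eq
      have hv_per (n : ℕ) := (iteratedDeriv_periodic hvp n).eq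
      have hu_per0 := hu_per 0
      have hv_per0 := hv_per 0
      simp only [iteratedDeriv_zero] at hu_per0 hv_per0
      simp only [hu_per, hv_per, hu_per0, hv_per0, sub_self]
    · have h0 := hasDerivAt_iteratedDeriv hu 0 x
      have h1 := hasDerivAt_iteratedDeriv hu 1 x
      have h2 := hasDerivAt_iteratedDeriv hu 2 x
      have h3 := hasDerivAt_iteratedDeriv hu 3 x
      have k0 := hasDerivAt_iteratedDeriv hv 0 x
      have k1 := hasDerivAt_iteratedDeriv hv 1 x
      simp only [iteratedDeriv_zero, zero_add, Nat.reduceAdd] at h0 h1 h2 h3 k0 k1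
      refine (((h2.mul k1).sub (h3.mul k0)).add
        ((((h0.pow 2).mul h1).mul k0).const_mul (c₁ / 4))).congr_deriv ?_
      simp only [Pi.pow_apply, Pi.mul_apply]
      push_cast
      ring

end MKdV5
end
end

section
/- There is a universal constant C (depending only on η₀) such that for all integers k, l ≥ 0 with l ≤ 5k and all f_k ∈ L²(ℝ×ℤ) supported in ℝ×I_k with ‖f_k‖_{X_k} < ∞: (i) Σ_{j=l+1}^∞ 2^{j/2} β_{j,k} ‖ η_j(τ−μ(n)) ∫_ℝ |f_k(τ′,n)| 2^{−l}(1+2^{−l}|τ−τ′|)^{−4} dτ′ ‖_{L²_τ ℓ²_n} + 2^{l/2} β_{l,k} ‖ η_{≤l}(τ−μ(n)) ∫_ℝ |f_k(τ′,n)| 2^{−l}(1+2^{−l}|τ−τ′|)^{−4} dτ′ ‖_{L²_τ ℓ²_n} ≤ C ‖f_k‖_{X_k}; (ii) in particular, for every t₀ ∈ ℝ and every Schwartz function γ ∈ 𝒮(ℝ), ‖ℱ[γ(2^l(t−t₀)) · ℱ^{−1}(f_k)]‖_{X_k} ≤ C_γ ‖f_k‖_{X_k}; and (iii) ‖ ∫_ℝ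 |f_k(τ′,n)| dτ′ ‖_{ℓ²_n} ≤ C ‖f_k‖_{X_k}. -/
noncomputable section

open scoped BigOperators ComplexConjugate
open MeasureTheory Complex Set

namespace MKdV5

/-! ### Sobolev data on the Fourier side.

A function `u ∈ H^s(𝕋)` (with `𝕋 = ℝ/2πℤ`) is represented by its sequence of Fourier
coefficients `a : ℤ → ℂ`, `a n = û(n) = (2π)^{-1/2}∫_𝕋 e^{-inx}u(x)dx`; real-valuedness of `u`
corresponds to `conj (a n) = a (-n)`. -/

/-- The weight `(1+n²)^s` of the `H^s(𝕋)` norm. -/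
def hsWeight (s : ℝ) (n : ℤ) : ℝ := (1 + (n : ℝ) ^ 2) ^ s

/-- `a` is (the sequence of Fourier coefficients of) an element of `H^s(𝕋)`. -/
def InHs (s : ℝ) (a : ℤ → ℂ) : Prop := Summable fun n : ℤ => hsWeight s n * ‖a n‖ ^ 2

/-- The square of the `H^s(𝕋)` norm. -/
def hsNormSq (s : ℝ) (a : ℤ → ℂ) : ℝ := ∑' n : ℤ, hsWeight s n * ‖a n‖ ^ 2

/-- The `H^s(𝕋)` norm. -/
def hsNorm (s : ℝ) (a : ℤ → ℂ) : ℝ := Real.sqrt (hsNormSq s a)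

/-- The Fourier coefficients of a real-valued function satisfy `conj (a n) = a (-n)`. -/
def IsRealCoeff (a : ℤ → ℂ) : Prop := ∀ n : ℤ, conj (a n) = a (-n)

/-- `u ∈ C([-T,T]; H^s(𝕋))`, on the Fourier side. -/
def ContHs (s T : ℝ) (u : ℝ → ℤ → ℂ) : Prop :=
  (∀ t ∈ Icc (-T) T, InHs s (u t)) ∧
    ∀ t ∈ Icc (-T) T, ∀ ε > 0, ∃ δ > 0, ∀ t' ∈ Icc (-T) T,
      |t' - t| < δ → hsNorm s (fun n => u t' n - u t n) < ε

/-- `u ∈ C([-T,T]; H^∞(𝕋))`. -/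
def ContHinf (T : ℝ) (u : ℝ → ℤ → ℂ) : Prop := ∀ s : ℝ, ContHs s T u

/-- The nonresonance condition defining `𝒩_{3,n}`. -/
abbrev N3cond (n₁ n₂ n₃ : ℤ) : Prop := (n₁ + n₂) * (n₁ + n₃) * (n₂ + n₃) ≠ 0

/-- The nonresonance condition defining `𝒩_{5,n}`: no four of the five frequencies sum to zero. -/
abbrev N5cond (n₁ n₂ n₃ n₄ n₅ : ℤ) : Prop :=
  n₁ + n₂ + n₃ + n₄ ≠ 0 ∧ n₁ + n₂ + n₃ + n₅ ≠ 0 ∧ n₁ + n₂ + n₄ + n₅ ≠ 0 ∧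
    n₁ + n₃ + n₄ + n₅ ≠ 0 ∧ n₂ + n₃ + n₄ + n₅ ≠ 0

/-- Sum over `(n₁,n₂,n₃) ∈ 𝒩_{3,n}` of `K(n₁,n₂,n₃)·a(n₁)b(n₂)c(n₃)`. -/
def cubicN3Sum (K : ℤ → ℤ → ℤ → ℂ) (a b c : ℤ → ℂ) (n : ℤ) : ℂ :=
  ∑' p : ℤ × ℤ, if N3cond p.1 p.2 (n - p.1 - p.2) then
    K p.1 p.2 (n - p.1 - p.2) * a p.1 * b p.2 * c (n - p.1 - p.2) else 0

/-- Sum over `(n₁,…,n₅) ∈ 𝒩_{5,n}` of `a₁(n₁)⋯a₅(n₅)`. -/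
def quinticN5Sum (a₁ a₂ a₃ a₄ a₅ : ℤ → ℂ) (n : ℤ) : ℂ :=
  ∑' q : ℤ × ℤ × ℤ × ℤ,
    if N5cond q.1 q.2.1 q.2.2.1 q.2.2.2 (n - q.1 - q.2.1 - q.2.2.1 - q.2.2.2) then
      a₁ q.1 * a₂ q.2.1 * a₃ q.2.2.1 * a₄ q.2.2.2 * a₅ (n - q.1 - q.2.1 - q.2.2.1 - q.2.2.2)
    else 0

/-- The dispersion relation `μ(n) = n⁵ + d₁n³ + d₂n`. -/
def muPhase (d₁ d₂ : ℝ) (n : ℤ) : ℝ := (n : ℝ) ^ 5 + d₁ * (n : ℝ) ^ 3 + d₂ * (n : ℝ)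

end MKdV5

namespace MKdV5

/-! ### Short-time function spaces `X_k`, `F_k`, `N_k`, `F^s(T)`, `N^s(T)`, `E^s(T)`. -/

/-- A smooth bump function `η₀ : ℝ → [0,1]` supported in `[-2,2]`, equal to `1` on `[-1,1]`. -/
structure BumpFun (η₀ : ℝ → ℝ) : Prop where
  smooth : ContDiff ℝ (⊤ : ℕ∞) η₀
  mem : ∀ x, η₀ x ∈ Icc (0 : ℝ) 1
  supp : ∀ x, 2 < |x| → η₀ x = 0
  eq_one : ∀ x ∈ Icc (-1 : ℝ) 1, η₀ x = 1

/-- The dyadic cutoffs `χ₀ = η₀`, `χ_k(ξ) = η₀(ξ/2^k) - η₀(ξ/2^{k-1})` for `k ≥ 1`. -/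
def chi (η₀ : ℝ → ℝ) : ℕ → ℝ → ℝ
  | 0 => η₀
  | k + 1 => fun ξ => η₀ (ξ / 2 ^ (k + 1)) - η₀ (ξ / 2 ^ k)

/-- `η_{≤l} = Σ_{j≤l} χ_j` (in the modulation variable). -/
def chiLe (η₀ : ℝ → ℝ) (l : ℕ) (x : ℝ) : ℝ := ∑ j ∈ Finset.range (l + 1), chi η₀ j x

/-- `χ_k` read on the integers. -/
def chiZ (η₀ : ℝ → ℝ) (k : ℕ) (n : ℤ) : ℝ := chi η₀ k (n : ℝ)

/-- `ψ_k(n) = n·χ_k'(n)`. -/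
def psiZ (η₀ : ℝ → ℝ) (k : ℕ) (n : ℤ) : ℝ := (n : ℝ) * deriv (chi η₀ k) (n : ℝ)

/-- The modulation weight `β_{j,k}`: `β_{j,0} = 1`, `β_{j,k} = 1 + 2^{(j-5k)/4}` for `k ≥ 1`. -/
def betaWt (j k : ℕ) : ℝ := if k = 0 then 1 else 1 + (2 : ℝ) ^ (((j : ℝ) - 5 * (k : ℝ)) / 4)

/-- The `L²_τ ℓ²_n` norm. -/
def l2l2 (f : ℝ → ℤ → ℂ) : ℝ := Real.sqrt (∫ τ : ℝ, ∑' n : ℤ, ‖f τ n‖ ^ 2)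

/-- The `X_k = X^{0,1/2,1}`-type norm with weights `β_{j,k}`. -/
def Xnorm (η₀ : ℝ → ℝ) (d₁ d₂ : ℝ) (k : ℕ) (f : ℝ → ℤ → ℂ) : ℝ :=
  ∑' j : ℕ, (2 : ℝ) ^ ((j : ℝ) / 2) * betaWt j k *
    l2l2 fun τ n => ((chi η₀ j (τ - muPhase d₁ d₂ n) : ℝ) : ℂ) * f τ n

/-- Finiteness of the `X_k` norm: measurability, square-integrability of each dyadic
modulation piece, and summability of the defining series. -/
def XFinite (η₀ : ℝ → ℝ) (d₁ d₂ : ℝ) (k : ℕ) (f : ℝ → ℤ → ℂ) : Prop :=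
  Measurable (Function.uncurry f) ∧
  (∀ j : ℕ, Integrable (fun τ : ℝ =>
      ∑' n : ℤ, ‖((chi η₀ j (τ - muPhase d₁ d₂ n) : ℝ) : ℂ) * f τ n‖ ^ 2)) ∧
  Summable (fun j : ℕ => (2 : ℝ) ^ ((j : ℝ) / 2) * betaWt j k *
    l2l2 fun τ n => ((chi η₀ j (τ - muPhase d₁ d₂ n) : ℝ) : ℂ) * f τ n)

/-- The Fourier transform in time. -/
def timeFT (u : ℝ → ℤ → ℂ) : ℝ → ℤ → ℂ := fun τ n =>
  ((Real.sqrt (2 * Real.pi) : ℝ) : ℂ)⁻¹ * ∫ t : ℝ, Complex.exp (-(I * (τ : ℂ) * (t : ℂ))) * u t n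

/-- The inverse Fourier transform in time. -/
def timeIFT (f : ℝ → ℤ → ℂ) : ℝ → ℤ → ℂ := fun t n =>
  ((Real.sqrt (2 * Real.pi) : ℝ) : ℂ)⁻¹ * ∫ τ : ℝ, Complex.exp (I * (τ : ℂ) * (t : ℂ)) * f τ n

/-- Localization of `u` to time scale `2^{-2k}` around `t_k`. -/
def timeLoc (η₀ : ℝ → ℝ) (k : ℕ) (tk : ℝ) (u : ℝ → ℤ → ℂ) : ℝ → ℤ → ℂ := fun t n =>
  ((η₀ ((2 : ℝ) ^ (2 * k) * (t - tk)) : ℝ) : ℂ) * u t n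

/-- The `F_k` norm: `sup_{t_k} ‖ℱ[u·η₀(2^{2k}(t-t_k))]‖_{X_k}`. -/
def FkNorm (η₀ : ℝ → ℝ) (d₁ d₂ : ℝ) (k : ℕ) (u : ℝ → ℤ → ℂ) : ℝ :=
  ⨆ tk : ℝ, Xnorm η₀ d₁ d₂ k (timeFT (timeLoc η₀ k tk u))

/-- Finiteness of the `F_k` norm. -/
def FkFinite (η₀ : ℝ → ℝ) (d₁ d₂ : ℝ) (k : ℕ) (u : ℝ → ℤ → ℂ) : Prop :=
  BddAbove (Set.range fun tk : ℝ => Xnorm η₀ d₁ d₂ k (timeFT (timeLoc η₀ k tk u)))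

/-- The `N_k` norm: `sup_{t_k} ‖(τ-μ(n)+i2^{2k})⁻¹ℱ[u·η₀(2^{2k}(t-t_k))]‖_{X_k}`. -/
def NkNorm (η₀ : ℝ → ℝ) (d₁ d₂ : ℝ) (k : ℕ) (u : ℝ → ℤ → ℂ) : ℝ :=
  ⨆ tk : ℝ, Xnorm η₀ d₁ d₂ k fun τ n =>
    ((τ : ℂ) - ((muPhase d₁ d₂ n : ℝ) : ℂ) + I * (((2 : ℝ) ^ (2 * k) : ℝ) : ℂ))⁻¹ *
      timeFT (timeLoc η₀ k tk u) τ n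

/-- The time-restricted norm `F_k(T)` (infimum over extensions from `[-T,T]`). -/
def FkTNorm (η₀ : ℝ → ℝ) (d₁ d₂ : ℝ) (k : ℕ) (T : ℝ) (u : ℝ → ℤ → ℂ) : ℝ :=
  sInf (FkNorm η₀ d₁ d₂ k '' {w | ∀ t ∈ Icc (-T) T, w t = u t})

/-- The time-restricted norm `N_k(T)` (infimum over extensions from `[-T,T]`). -/
def NkTNorm (η₀ : ℝ → ℝ) (d₁ d₂ : ℝ) (k : ℕ) (T : ℝ) (u : ℝ → ℤ → ℂ) : ℝ :=
  sInf (NkNorm η₀ d₁ d₂ k '' {w | ∀ t ∈ Icc (-T) T, w t = u t})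

/-- The Littlewood-Paley projection `P_k`. -/
def Pk (η₀ : ℝ → ℝ) (k : ℕ) (u : ℝ → ℤ → ℂ) : ℝ → ℤ → ℂ := fun t n =>
  ((chiZ η₀ k n : ℝ) : ℂ) * u t n

/-- `‖u‖²_{F^s(T)} = Σ_k 2^{2sk}‖P_k u‖²_{F_k(T)}`. -/
def FsTNormSq (η₀ : ℝ → ℝ) (d₁ d₂ s T : ℝ) (u : ℝ → ℤ → ℂ) : ℝ :=
  ∑' k : ℕ, (2 : ℝ) ^ (2 * s * (k : ℝ)) * (FkTNorm η₀ d₁ d₂ k T (Pk η₀ k u)) ^ 2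

/-- The `F^s(T)` norm. -/
def FsTNorm (η₀ : ℝ → ℝ) (d₁ d₂ s T : ℝ) (u : ℝ → ℤ → ℂ) : ℝ :=
  Real.sqrt (FsTNormSq η₀ d₁ d₂ s T u)

/-- Membership in `F^s(T)` (finiteness of the norm). -/
def MemFsT (η₀ : ℝ → ℝ) (d₁ d₂ s T : ℝ) (u : ℝ → ℤ → ℂ) : Prop :=
  Summable fun k : ℕ => (2 : ℝ) ^ (2 * s * (k : ℝ)) * (FkTNorm η₀ d₁ d₂ k T (Pk η₀ k u)) ^ 2

/-- `‖u‖²_{N^s(T)} = Σ_k 2^{2sk}‖P_k u‖²_{N_k(T)}`. -/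
def NsTNormSq (η₀ : ℝ → ℝ) (d₁ d₂ s T : ℝ) (u : ℝ → ℤ → ℂ) : ℝ :=
  ∑' k : ℕ, (2 : ℝ) ^ (2 * s * (k : ℝ)) * (NkTNorm η₀ d₁ d₂ k T (Pk η₀ k u)) ^ 2

/-- The `N^s(T)` norm. -/
def NsTNorm (η₀ : ℝ → ℝ) (d₁ d₂ s T : ℝ) (u : ℝ → ℤ → ℂ) : ℝ :=
  Real.sqrt (NsTNormSq η₀ d₁ d₂ s T u)

/-- `‖u‖²_{E^s(T)} = ‖P₀u(0)‖²_{L²} + Σ_{k≥1} sup_{t_k∈[-T,T]} 2^{2sk}‖P_k u(t_k)‖²_{L²}`. -/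
def EsTNormSq (η₀ : ℝ → ℝ) (s T : ℝ) (u : ℝ → ℤ → ℂ) : ℝ :=
  (∑' n : ℤ, ‖((chiZ η₀ 0 n : ℝ) : ℂ) * u 0 n‖ ^ 2) +
    ∑' k : ℕ, sSup ((fun t : ℝ => (2 : ℝ) ^ (2 * s * ((k : ℝ) + 1)) *
      ∑' n : ℤ, ‖((chiZ η₀ (k + 1) n : ℝ) : ℂ) * u t n‖ ^ 2) '' Icc (-T) T)

/-- The `E^s(T)` norm. -/
def EsTNorm (η₀ : ℝ → ℝ) (s T : ℝ) (u : ℝ → ℤ → ℂ) : ℝ :=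
  Real.sqrt (EsTNormSq η₀ s T u)

end MKdV5
namespace MKdV5

/-- Membership in `F_k(T)`: some extension from `[-T,T]` has finite `F_k` norm. -/
def FkTFinite (η₀ : ℝ → ℝ) (d₁ d₂ : ℝ) (k : ℕ) (T : ℝ) (u : ℝ → ℤ → ℂ) : Prop :=
  ∃ w : ℝ → ℤ → ℂ, (∀ t ∈ Icc (-T) T, w t = u t) ∧ FkFinite η₀ d₁ d₂ k w

end MKdV5

namespace MKdV5

/-! ### The quadrilinear functional `J` and the dyadic regions `D_{k,j}`. -/

/-- The dyadic region `I_k`, read inside `ℝ`. -/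
def IkR (k : ℕ) : Set ℝ :=
  if k = 0 then {x | |x| ≤ 2} else {x | (2 : ℝ) ^ (k - 1) ≤ |x| ∧ |x| ≤ (2 : ℝ) ^ (k + 1)}

/-- `f` is supported in `D_{k,j} = {(τ,n) : n ∈ I_k, τ - μ(n) ∈ I_j}`. -/
def InDkj (d₁ d₂ : ℝ) (k j : ℕ) (f : ℝ → ℤ → ℝ) : Prop :=
  ∀ τ n, f τ n ≠ 0 → (n : ℝ) ∈ IkR k ∧ τ - muPhase d₁ d₂ n ∈ IkR j

/-- The `L²(ℝ×ℤ)` norm of a real-valued function. -/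
def l2R (f : ℝ → ℤ → ℝ) : ℝ := Real.sqrt (∫ τ : ℝ, ∑' n : ℤ, f τ n ^ 2)

/-- Finiteness of the `L²(ℝ×ℤ)` norm. -/
def L2Finite (f : ℝ → ℤ → ℝ) : Prop :=
  Measurable (Function.uncurry f) ∧ Integrable (fun τ : ℝ => ∑' n : ℤ, f τ n ^ 2)

/-- The quadrilinear functional
`J(f₁,f₂,f₃,f₄) = Σ_{n₄} Σ_{(n₁,n₂,n₃)∈𝒩_{3,n₄}} ∫_{ζ₁+ζ₂+ζ₃=ζ₄+G} f₁f₂f₃f₄`,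
with the hyperplane parametrized by `(ζ₁,ζ₂,ζ₃)` (on which `f₄` is evaluated at
`ζ₄ + G = ζ₁+ζ₂+ζ₃`). -/
def Jfun (f₁ f₂ f₃ f₄ : ℝ → ℤ → ℝ) : ℝ :=
  ∑' n₄ : ℤ, ∑' p : ℤ × ℤ × ℤ,
    if p.1 + p.2.1 + p.2.2 = n₄ ∧ N3cond p.1 p.2.1 p.2.2 then
      ∫ ζ : ℝ × ℝ × ℝ,
        f₁ ζ.1 p.1 * f₂ ζ.2.1 p.2.1 * f₃ ζ.2.2 p.2.2 * f₄ (ζ.1 + ζ.2.1 + ζ.2.2) n₄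
    else 0

/-- Maximum of four naturals. -/
def max4 (a b c d : ℕ) : ℕ := max (max a b) (max c d)

/-- Minimum of four naturals. -/
def min4 (a b c d : ℕ) : ℕ := min (min a b) (min c d)

/-- Second largest of four naturals. -/
def sub4 (a b c d : ℕ) : ℕ :=
  min (min (max b (max c d)) (max a (max c d))) (min (max a (max b d)) (max a (max b c)))

/-- Third largest of four naturals. -/
def thd4 (a b c d : ℕ) : ℕ :=
  max (max (min b (min c d)) (min a (min c d))) (max (min a (min b d)) (min a (min b c)))

end MKdV5

namespace MKdV5

open scoped ENNReal

/-- The `L²` norm of an `ℝ≥0∞`-valued function. -/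
def lTwo {α : Type*} [MeasurableSpace α] (μ : Measure α) (f : α → ℝ≥0∞) : ℝ≥0∞ :=
  (∫⁻ a, f a ^ 2 ∂μ) ^ (1 / 2 : ℝ)

section LTwo

variable {α : Type*} [MeasurableSpace α] {μ : Measure α}

lemma rpow_half_sq (x : ℝ≥0∞) : (x ^ (1 / 2 : ℝ)) ^ 2 = x := by
  rw [← ENNReal.rpow_natCast, ← ENNReal.rpow_mul]; norm_num

lemma sq_rpow_half (x : ℝ≥0∞) : (x ^ 2) ^ (1 / 2 : ℝ) = x := by
  rw [← ENNReal.rpow_natCast, ← ENNReal.rpow_mul]; norm_num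

lemma lTwo_sq (f : α → ℝ≥0∞) : lTwo μ f ^ 2 = ∫⁻ a, f a ^ 2 ∂μ := rpow_half_sq _

lemma lTwo_mono {f g : α → ℝ≥0∞} (h : ∀ a, f a ≤ g a) : lTwo μ f ≤ lTwo μ g := by
  unfold lTwo
  gcongr with a
  exact h a

lemma lTwo_le_of_sq {f : α → ℝ≥0∞} {c : ℝ≥0∞} (h : ∫⁻ a, f a ^ 2 ∂μ ≤ c ^ 2) :
    lTwo μ f ≤ c := by
  rw [← sq_rpow_half c]
  unfold lTwo
  gcongr

lemma lTwo_add_le {f g : α → ℝ≥0∞} (hf : Measurable f) (hg : Measurable g) :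
    lTwo μ (fun a => f a + g a) ≤ lTwo μ f + lTwo μ g := by
  have := ENNReal.lintegral_Lp_add_le (μ := μ) (p := 2) hf.aemeasurable hg.aemeasurable
    (by norm_num)
  simpa [lTwo] using this

lemma lTwo_sum_le {f : ℕ → α → ℝ≥0∞} (hf : ∀ i, Measurable (f i)) (N : ℕ) :
    lTwo μ (fun a => ∑ i ∈ Finset.range N, f i a) ≤ ∑ i ∈ Finset.range N, lTwo μ (f i) := by
  induction N with
  | zero => simp [lTwo]
  | succ N ih =>
    simp only [Finset.sum_range_succ]
    exact (lTwo_add_le (Finset.measurable_fun_sum _ fun i _ => hf i) (hf N)).trans (by gcongr)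

/-- Minkowski's inequality for countable sums. -/
lemma lTwo_tsum_le {f : ℕ → α → ℝ≥0∞} (hf : ∀ i, Measurable (f i)) :
    lTwo μ (fun a => ∑' i, f i a) ≤ ∑' i, lTwo μ (f i) := by
  apply lTwo_le_of_sq
  have h1 : ∀ a, (∑' i, f i a) ^ 2 = ⨆ N : ℕ, (∑ i ∈ Finset.range N, f i a) ^ 2 := fun a => by
    have ht : Filter.Tendsto (fun N => (∑ i ∈ Finset.range N, f i a) ^ 2) Filter.atTop
        (nhds ((∑' i, f i a) ^ 2)) :=
      ((ENNReal.continuous_pow 2).tendsto _).comp (ENNReal.tendsto_nat_tsum fun i => f i a)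
    refine (tendsto_nhds_unique ht (tendsto_atTop_iSup ?_))
    intro M N hMN
    dsimp only
    gcongr
  simp only [h1]
  rw [lintegral_iSup]
  · refine iSup_le fun N => ?_
    rw [← lTwo_sq (fun a => ∑ i ∈ Finset.range N, f i a)]
    gcongr
    exact (lTwo_sum_le hf N).trans (ENNReal.sum_le_tsum _)
  · exact fun N => (Finset.measurable_fun_sum _ fun i _ => hf i).pow_const 2
  · intro M N hMN a
    dsimp only
    gcongr

/-- The Cauchy–Schwarz inequality. -/
lemma sq_lintegral_mul_le {f g : α → ℝ≥0∞} (hf : Measurable f) (hg : Measurable g) :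
    (∫⁻ a, f a * g a ∂μ) ^ 2 ≤ (∫⁻ a, f a ^ 2 ∂μ) * ∫⁻ a, g a ^ 2 ∂μ := by
  have h : ∫⁻ a, f a * g a ∂μ ≤ lTwo μ f * lTwo μ g := by
    simpa [lTwo] using ENNReal.lintegral_mul_le_Lp_mul_Lq μ Real.HolderConjugate.two_two
      hf.aemeasurable hg.aemeasurable
  calc _ ≤ (lTwo μ f * lTwo μ g) ^ 2 := by gcongr
    _ = _ := by rw [mul_pow, lTwo_sq, lTwo_sq]

lemma sq_lintegral_mul_weight_le {f k : α → ℝ≥0∞} (hf : Measurable f) (hk : Measurable k) :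
    (∫⁻ a, f a * k a ∂μ) ^ 2 ≤ (∫⁻ a, k a ∂μ) * ∫⁻ a, f a ^ 2 * k a ∂μ := by
  have h := sq_lintegral_mul_le (μ := μ) (f := fun a => f a * k a ^ (1 / 2 : ℝ))
    (g := fun a => k a ^ (1 / 2 : ℝ)) (hf.mul (hk.pow_const _)) (hk.pow_const _)
  simp only [mul_pow, mul_assoc, ← sq, rpow_half_sq] at h
  rwa [mul_comm] at h

lemma sq_lintegral_le_of_support {f : α → ℝ≥0∞} (hf : Measurable f) {S : Set α}
    (hS : MeasurableSet S) (h : ∀ a ∉ S, f a = 0) :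
    (∫⁻ a, f a ∂μ) ^ 2 ≤ μ S * ∫⁻ a, f a ^ 2 ∂μ := by
  have h1 := sq_lintegral_mul_le (μ := μ) hf
    ((measurable_const (a := (1 : ℝ≥0∞))).indicator hS)
  have h2 : ∀ a, f a * S.indicator (fun _ => 1) a = f a := fun a => by
    by_cases ha : a ∈ S <;> simp [ha, h]
  have h3 : ∀ a, (S.indicator (fun _ => (1 : ℝ≥0∞)) a) ^ 2 = S.indicator (fun _ => 1) a :=
    fun a => by by_cases ha : a ∈ S <;> simp [ha]
  simp only [h2, h3, lintegral_indicator hS, setLIntegral_const, one_mul] at h1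
  rwa [mul_comm] at h1

end LTwo

/-- The convolution operator with kernel `K`. -/
def convK (K : ℝ → ℝ≥0∞) (g : ℝ → ℝ≥0∞) (τ : ℝ) : ℝ≥0∞ := ∫⁻ τ', g τ' * K (τ - τ')

lemma measurable_convK {K g : ℝ → ℝ≥0∞} (hK : Measurable K) (hg : Measurable g) :
    Measurable (convK K g) := by
  unfold convK
  apply Measurable.lintegral_prod_right'
    (f := fun p : ℝ × ℝ => g p.2 * K (p.1 - p.2))
  fun_prop

/-- Young's inequality `L¹ * L² ⊆ L²`. -/
lemma lTwo_convK_le {K g : ℝ → ℝ≥0∞} (hK : Measurable K) (hg : Measurable g) :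
    lTwo volume (convK K g) ≤ (∫⁻ x, K x) * lTwo volume g := by
  apply lTwo_le_of_sq
  calc ∫⁻ τ, convK K g τ ^ 2
      ≤ ∫⁻ τ, (∫⁻ x, K x) * ∫⁻ τ', g τ' ^ 2 * K (τ - τ') := by
        refine lintegral_mono fun τ => ?_
        have := sq_lintegral_mul_weight_le (μ := volume) hg
          (k := fun τ' => K (τ - τ')) (by fun_prop)
        rwa [lintegral_sub_left_eq_self K τ] at this
    _ = (∫⁻ x, K x) * ∫⁻ τ', ∫⁻ τ, g τ' ^ 2 * K (τ - τ') := by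
        rw [lintegral_const_mul, lintegral_lintegral_swap]
        · fun_prop
        · apply Measurable.lintegral_prod_right'
            (f := fun p : ℝ × ℝ => g p.2 ^ 2 * K (p.1 - p.2))
          fun_prop
    _ = (∫⁻ x, K x) * ∫⁻ τ', g τ' ^ 2 * ∫⁻ x, K x := by
        congr 1
        refine lintegral_congr fun τ' => ?_
        rw [lintegral_const_mul _ (by fun_prop), lintegral_sub_right_eq_self K τ']
    _ = _ := by
        rw [lintegral_mul_const _ (by fun_prop), mul_pow, lTwo_sq]; ring

/-- Bound for the piece of a convolution with separated supports. -/
lemma lTwo_mul_convK_le {K g a : ℝ → ℝ≥0∞} (hg : Measurable g) {A B : Set ℝ}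
    (hA : MeasurableSet A) (hB : MeasurableSet B) (ha1 : ∀ x, a x ≤ 1) (ha : ∀ x ∉ A, a x = 0)
    (hgB : ∀ x ∉ B, g x = 0) {κ : ℝ≥0∞} (hκ : ∀ τ, a τ ≠ 0 → ∀ τ', g τ' ≠ 0 → K (τ - τ') ≤ κ)
    {u v : ℝ≥0∞} (hu : volume A ≤ u ^ 2) (hv : volume B ≤ v ^ 2) :
    lTwo volume (fun τ => a τ * convK K g τ) ≤ κ * u * v * lTwo volume g := by
  apply lTwo_le_of_sq
  have h1 : ∀ τ, (a τ * convK K g τ) ^ 2 ≤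
      A.indicator (fun _ => (κ * ∫⁻ τ', g τ') ^ 2) τ := fun τ => by
    by_cases hτ : a τ = 0
    · simp [hτ]
    have hτA : τ ∈ A := by_contra fun h => hτ (ha τ h)
    rw [Set.indicator_of_mem hτA, ← lintegral_const_mul _ hg]
    gcongr
    refine (mul_le_of_le_one_left' (ha1 τ)).trans (lintegral_mono fun τ' => ?_)
    by_cases h0 : g τ' = 0
    · simp [h0]
    · rw [mul_comm]
      gcongr
      exact hκ τ hτ τ' h0
  calc _ ≤ _ := lintegral_mono h1
    _ = κ ^ 2 * (∫⁻ τ', g τ') ^ 2 * volume A := by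
        rw [lintegral_indicator hA, setLIntegral_const, mul_pow]
    _ ≤ κ ^ 2 * (v ^ 2 * ∫⁻ τ', g τ' ^ 2) * u ^ 2 := by
        gcongr
        exact (sq_lintegral_le_of_support hg hB hgB).trans (by gcongr)
    _ = _ := by rw [mul_pow, lTwo_sq]; ring

section Cutoffs

variable {η₀ : ℝ → ℝ}

lemma abs_chi_le_one (hη : BumpFun η₀) (j : ℕ) (x : ℝ) : |chi η₀ j x| ≤ 1 := by
  cases j with
  | zero =>
    have h1 := hη.mem x
    exact abs_le.2 ⟨by simp only [chi]; linarith [h1.1], h1.2⟩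
  | succ j =>
    have h1 := hη.mem (x / 2 ^ (j + 1))
    have h2 := hη.mem (x / 2 ^ j)
    exact abs_le.2 ⟨by simp only [chi]; linarith [h1.1, h2.2],
      by simp only [chi]; linarith [h1.2, h2.1]⟩

lemma BumpFun.div_pow_eq_zero (hη : BumpFun η₀) {j : ℕ} {x : ℝ} (h : 2 ^ (j + 1) < |x|) :
    η₀ (x / 2 ^ j) = 0 := by
  apply hη.supp
  rw [abs_div, abs_of_pos (by positivity : (0 : ℝ) < 2 ^ j), lt_div_iff₀ (by positivity)]
  rw [pow_succ] at h
  linarith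

lemma BumpFun.div_pow_eq_one (hη : BumpFun η₀) {j : ℕ} {x : ℝ} (h : |x| ≤ 2 ^ j) :
    η₀ (x / 2 ^ j) = 1 := by
  refine hη.eq_one _ (abs_le.1 ?_)
  rw [abs_div, abs_of_pos (by positivity : (0 : ℝ) < 2 ^ j), div_le_one (by positivity)]
  exact h

lemma abs_le_of_chi_ne_zero (hη : BumpFun η₀) {j : ℕ} {x : ℝ} (h : chi η₀ j x ≠ 0) :
    |x| ≤ 2 ^ (j + 1) := by
  by_contra! hx
  apply h
  cases j with
  | zero => simpa [chi] using hη.div_pow_eq_zero hx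
  | succ j =>
    have h2 : (2 : ℝ) ^ (j + 1) < |x| := lt_of_le_of_lt
      (pow_le_pow_right₀ (by norm_num) (by omega)) hx
    simp only [chi, hη.div_pow_eq_zero hx, hη.div_pow_eq_zero h2, sub_zero]

lemma le_abs_of_chi_succ_ne_zero (hη : BumpFun η₀) {j : ℕ} {x : ℝ} (h : chi η₀ (j + 1) x ≠ 0) :
    2 ^ j ≤ |x| := by
  by_contra! hx
  apply h
  have h2 : |x| ≤ (2 : ℝ) ^ (j + 1) := hx.le.trans
    (pow_le_pow_right₀ (by norm_num) (by omega))
  simp only [chi, hη.div_pow_eq_one hx.le, hη.div_pow_eq_one h2, sub_self]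

lemma chiLe_eq (l : ℕ) (x : ℝ) : chiLe η₀ l x = η₀ (x / 2 ^ l) := by
  induction l with
  | zero => simp [chiLe, chi]
  | succ l ih =>
    rw [chiLe, Finset.sum_range_succ, ← chiLe, ih]
    simp [chi]

lemma one_le_tsum_chi (hη : BumpFun η₀) (x : ℝ) : 1 ≤ ∑' j, ‖chi η₀ j x‖ₑ := by
  obtain ⟨N, hN⟩ := pow_unbounded_of_one_lt |x| (by norm_num : (1 : ℝ) < 2)
  have h1 : ∑ j ∈ Finset.range (N + 1), chi η₀ j x = 1 := by
    rw [← chiLe, chiLe_eq, hη.div_pow_eq_one hN.le]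
  calc (1 : ℝ≥0∞) = ‖∑ j ∈ Finset.range (N + 1), chi η₀ j x‖ₑ := by rw [h1]; simp
    _ ≤ ∑ j ∈ Finset.range (N + 1), ‖chi η₀ j x‖ₑ := enorm_sum_le _ _
    _ ≤ _ := ENNReal.sum_le_tsum _

lemma measurable_chi (hη : BumpFun η₀) (j : ℕ) : Measurable (chi η₀ j) := by
  have := hη.smooth.continuous.measurable
  cases j with
  | zero => exact this
  | succ j => simp only [chi]; fun_prop

end Cutoffs

/-- The kernel `2^{-l}(1+2^{-l}|x|)^{-4}`. -/
def kerL (l : ℕ) (x : ℝ) : ℝ≥0∞ :=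
  ENNReal.ofReal ((2 : ℝ) ^ (-(l : ℝ)) / (1 + (2 : ℝ) ^ (-(l : ℝ)) * |x|) ^ 4)

lemma measurable_kerL (l : ℕ) : Measurable (kerL l) := by
  unfold kerL
  fun_prop

lemma kerL_le {l : ℕ} {x r : ℝ} (hr : 0 ≤ r) (h : r ≤ |x|) :
    kerL l x ≤ ENNReal.ofReal ((2 : ℝ) ^ (-(l : ℝ)) / (1 + (2 : ℝ) ^ (-(l : ℝ)) * r) ^ 4) := by
  unfold kerL
  gcongr

/-- The `L¹` norm of `(1+|x|)^{-4}`. -/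
def kerMass : ℝ≥0∞ := ∫⁻ x : ℝ, ENNReal.ofReal ((1 + ‖x‖) ^ (-4 : ℝ))

lemma kerMass_lt_top : kerMass < ∞ := finite_integral_one_add_norm (by norm_num)

lemma lintegral_kerL (l : ℕ) : ∫⁻ x, kerL l x = kerMass := by
  have hp : (0 : ℝ) < 2 ^ (-(l : ℝ)) := by positivity
  have h := lintegral_map (μ := volume) (f := fun x : ℝ => ENNReal.ofReal ((1 + ‖x‖) ^ (-4 : ℝ)))
    (g := fun x => (2 : ℝ) ^ (-(l : ℝ)) * x) (by fun_prop) (by fun_prop)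
  rw [Real.map_volume_mul_left hp.ne', lintegral_smul_measure, abs_of_pos (by positivity)] at h
  have h2 : ∀ x, kerL l x = ENNReal.ofReal ((2 : ℝ) ^ (-(l : ℝ))) *
      ENNReal.ofReal ((1 + ‖(2 : ℝ) ^ (-(l : ℝ)) * x‖) ^ (-4 : ℝ)) := fun x => by
    rw [← ENNReal.ofReal_mul hp.le, kerL, norm_mul, Real.norm_eq_abs, Real.norm_eq_abs,
      abs_of_pos hp, Real.rpow_neg (by positivity) 4, div_eq_mul_inv]
    norm_cast
  simp only [h2]
  rw [lintegral_const_mul _ (by fun_prop), ← h, smul_eq_mul, ← mul_assoc,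
    ← ENNReal.ofReal_mul hp.le, mul_inv_cancel₀ hp.ne', ENNReal.ofReal_one, one_mul, kerMass]

section Weights

/-- The weight of the `j`-th modulation piece in the `X_k` norm. -/
def modWt (j k : ℕ) : ℝ := (2 : ℝ) ^ ((j : ℝ) / 2) * betaWt j k

lemma one_le_betaWt (j k : ℕ) : 1 ≤ betaWt j k := by
  unfold betaWt
  split_ifs
  · exact le_rfl
  · have : (0 : ℝ) < 2 ^ (((j : ℝ) - 5 * k) / 4) := by positivity
    linarith

lemma modWt_pos (j k : ℕ) : 0 < modWt j k :=
  mul_pos (by positivity) (by linarith [one_le_betaWt j k])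

lemma two_rpow_le_modWt (j k : ℕ) : (2 : ℝ) ^ ((j : ℝ) / 2) ≤ modWt j k :=
  le_mul_of_one_le_right (by positivity) (one_le_betaWt j k)

lemma betaWt_mono {i j : ℕ} (h : i ≤ j) (k : ℕ) : betaWt i k ≤ betaWt j k := by
  unfold betaWt
  split_ifs
  · exact le_rfl
  · gcongr
    norm_num

lemma betaWt_le_two_mul {i j : ℕ} (h : j ≤ i + 2) (k : ℕ) : betaWt j k ≤ 2 * betaWt i k := by
  refine (betaWt_mono h k).trans ?_
  unfold betaWt
  split_ifs
  · norm_num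
  · have h1 : (2 : ℝ) ^ ((((i + 2 : ℕ) : ℝ) - 5 * k) / 4) ≤
        2 * (2 : ℝ) ^ (((i : ℝ) - 5 * k) / 4) := by
      nth_rewrite 2 [← Real.rpow_one 2]
      rw [← Real.rpow_add (by norm_num)]
      apply Real.rpow_le_rpow_of_exponent_le (by norm_num)
      push_cast
      linarith
    linarith

lemma betaWt_le {k l : ℕ} (h : l ≤ 5 * k) (j : ℕ) :
    betaWt j k ≤ 1 + (2 : ℝ) ^ (((j : ℝ) - l) / 4) := by
  unfold betaWt
  split_ifs
  · have : (0 : ℝ) < 2 ^ (((j : ℝ) - l) / 4) := by positivity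
    linarith
  · gcongr
    · norm_num
    · exact_mod_cast h

lemma modWt_mono {i j : ℕ} (h : i ≤ j) (k : ℕ) : modWt i k ≤ modWt j k := by
  unfold modWt
  have := one_le_betaWt i k
  gcongr
  · norm_num
  · exact betaWt_mono h k

lemma modWt_self_le {k l : ℕ} (h : l ≤ 5 * k) : modWt l k ≤ 2 * (2 : ℝ) ^ ((l : ℝ) / 2) := by
  have h1 := betaWt_le h l
  rw [sub_self, zero_div, Real.rpow_zero] at h1
  have h2 : (0 : ℝ) < 2 ^ ((l : ℝ) / 2) := by positivity
  unfold modWt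
  nlinarith

/-- The two-sided geometric weight `2^{-|s|/2}`. -/
def geomWt (s : ℤ) : ℝ := (2 : ℝ) ^ (-(|(s : ℝ)| / 2))

lemma geomWt_pos (s : ℤ) : 0 < geomWt s := by unfold geomWt; positivity

lemma summable_geomWt : Summable geomWt := by
  have h0 : Summable fun n : ℕ => ((2 : ℝ) ^ (-(1 / 2) : ℝ)) ^ n :=
    summable_geometric_of_lt_one (by positivity)
      (Real.rpow_lt_one_of_one_lt_of_neg (by norm_num) (by norm_num))
  have h1 : ∀ n : ℕ, ((2 : ℝ) ^ (-(1 / 2) : ℝ)) ^ n = (2 : ℝ) ^ (-((n : ℝ) / 2)) := fun n => by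
    rw [← Real.rpow_natCast, ← Real.rpow_mul (by norm_num)]
    congr 1; ring
  simp only [h1] at h0
  refine Summable.of_nat_of_neg ?_ ?_ <;> simpa [geomWt] using h0

/-- The sum of `geomWt`. -/
def geomSum : ℝ≥0∞ := ∑' s : ℤ, ENNReal.ofReal (geomWt s)

lemma geomSum_lt_top : geomSum < ∞ := by
  rw [geomSum, ← ENNReal.ofReal_tsum_of_nonneg (fun s => (geomWt_pos s).le) summable_geomWt]
  exact ENNReal.ofReal_lt_top

lemma tsum_geomWt_le (l : ℕ) :
    ∑' j : ℕ, ENNReal.ofReal (geomWt ((j : ℤ) - l)) ≤ geomSum :=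
  ENNReal.tsum_comp_le_tsum_of_injective (f := fun j : ℕ => (j : ℤ) - l)
    (fun a b h => by simpa using h) fun s => ENNReal.ofReal (geomWt s)

lemma modWt_le_geomWt {i j : ℕ} (h : j ≤ i + 2) (k : ℕ) :
    modWt j k ≤ 8 * modWt i k * geomWt ((j : ℤ) - i) := by
  have h1 : (2 : ℝ) ^ ((j : ℝ) / 2) ≤ 4 * (2 : ℝ) ^ ((i : ℝ) / 2) * geomWt ((j : ℤ) - i) := by
    have h4 : (4 : ℝ) = (2 : ℝ) ^ (2 : ℝ) := by norm_num
    rw [geomWt, h4, ← Real.rpow_add (by norm_num), ← Real.rpow_add (by norm_num)]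
    apply Real.rpow_le_rpow_of_exponent_le (by norm_num)
    have hj : (j : ℝ) ≤ i + 2 := by exact_mod_cast h
    push_cast
    rcases abs_cases ((j : ℝ) - i) with ⟨h, _⟩ | ⟨h, _⟩ <;> rw [h] <;> linarith
  have h2 := betaWt_le_two_mul h k
  have h3 := one_le_betaWt j k
  have h5 := geomWt_pos ((j : ℤ) - i)
  calc modWt j k ≤ (4 * (2 : ℝ) ^ ((i : ℝ) / 2) * geomWt ((j : ℤ) - i)) * (2 * betaWt i k) := by
        unfold modWt; gcongr
    _ = _ := by unfold modWt; ring

lemma modWt_mul_decay_le {k l : ℕ} (h : l ≤ 5 * k) (i j : ℕ) :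
    modWt j k * ((2 : ℝ) ^ (-(l : ℝ)) / (1 + (2 : ℝ) ^ (-(l : ℝ)) * (2 ^ j / 4)) ^ 4 *
      (2 * (2 : ℝ) ^ ((j : ℝ) / 2)) * (2 * (2 : ℝ) ^ ((i : ℝ) / 2))) ≤
      2048 * modWt i k * geomWt ((j : ℤ) - l) := by
  set x : ℝ := (2 : ℝ) ^ ((j : ℝ) - l) with hx
  have hx0 : 0 < x := by positivity
  have hxl : (2 : ℝ) ^ (-(l : ℝ)) * 2 ^ j = x := by
    rw [hx, ← Real.rpow_natCast, ← Real.rpow_add (by norm_num)]; congr 1; ring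
  have hjj : (2 : ℝ) ^ ((j : ℝ) / 2) * (2 : ℝ) ^ ((j : ℝ) / 2) = 2 ^ j := by
    rw [← Real.rpow_add (by norm_num), ← Real.rpow_natCast]; congr 1; ring
  have hβ : betaWt j k ≤ 2 * (1 + x) := by
    refine (betaWt_le h j).trans ?_
    have : (2 : ℝ) ^ (((j : ℝ) - l) / 4) ≤ 1 + x := by
      rcases le_total 0 ((j : ℝ) - l) with h0 | h0
      · have : (2 : ℝ) ^ (((j : ℝ) - l) / 4) ≤ x :=
          Real.rpow_le_rpow_of_exponent_le (by norm_num) (by linarith)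
        linarith
      · have : (2 : ℝ) ^ (((j : ℝ) - l) / 4) ≤ 1 :=
          Real.rpow_le_one_of_one_le_of_nonpos (by norm_num) (by linarith)
        linarith
    linarith
  have hg : x ≤ geomWt ((j : ℤ) - l) * (1 + x) ^ 3 := by
    unfold geomWt
    push_cast
    rcases le_total 0 ((j : ℝ) - l) with h0 | h0
    · rw [abs_of_nonneg h0]
      have h1 : x * (2 : ℝ) ^ (-(((j : ℝ) - l) / 2)) ≥ 1 := by
        rw [hx, ← Real.rpow_add (by norm_num)]
        exact Real.one_le_rpow (by norm_num) (by linarith)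
      have : 0 < (2 : ℝ) ^ (-(((j : ℝ) - l) / 2)) := by positivity
      nlinarith [mul_pos this hx0, mul_pos (mul_pos this hx0) hx0,
        mul_pos (mul_pos (mul_pos this hx0) hx0) hx0]
    · rw [abs_of_nonpos h0]
      have h1 : x ≤ (2 : ℝ) ^ (-(-((j : ℝ) - l) / 2)) :=
        Real.rpow_le_rpow_of_exponent_le (by norm_num) (by linarith)
      exact h1.trans (le_mul_of_one_le_right (by positivity)
        (one_le_pow₀ (by linarith)))
  have hden : (1 + x) ^ 4 ≤ 256 * (1 + (2 : ℝ) ^ (-(l : ℝ)) * (2 ^ j / 4)) ^ 4 := by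
    rw [mul_div_assoc', hxl]
    calc (1 + x) ^ 4 ≤ (4 * (1 + x / 4)) ^ 4 := by gcongr; linarith
      _ = _ := by ring
  set D := (1 + (2 : ℝ) ^ (-(l : ℝ)) * (2 ^ j / 4)) ^ 4 with hD
  have hD0 : 0 < D := by positivity
  have hi := two_rpow_le_modWt i k
  have hgp := geomWt_pos ((j : ℤ) - l)
  have key : betaWt j k * (4 * x) / D ≤ 2048 * geomWt ((j : ℤ) - l) := by
    rw [div_le_iff₀ hD0]
    calc betaWt j k * (4 * x) ≤ (2 * (1 + x)) * (4 * (geomWt ((j : ℤ) - l) * (1 + x) ^ 3)) := by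
          gcongr
      _ = 8 * geomWt ((j : ℤ) - l) * (1 + x) ^ 4 := by ring
      _ ≤ 8 * geomWt ((j : ℤ) - l) * (256 * D) := by gcongr
      _ = _ := by ring
  calc _ = betaWt j k * (4 * ((2 : ℝ) ^ (-(l : ℝ)) *
        ((2 : ℝ) ^ ((j : ℝ) / 2) * (2 : ℝ) ^ ((j : ℝ) / 2)))) / D * (2 : ℝ) ^ ((i : ℝ) / 2) := by
        unfold modWt; ring
    _ = betaWt j k * (4 * x) / D * (2 : ℝ) ^ ((i : ℝ) / 2) := by rw [hjj, hxl]
    _ ≤ (2048 * geomWt ((j : ℤ) - l)) * modWt i k := by gcongr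
    _ = _ := by ring

lemma modWt_self_mul_le {k l : ℕ} (h : l ≤ 5 * k) (i : ℕ) :
    modWt l k * ((2 : ℝ) ^ (-(l : ℝ)) * (2 * (2 : ℝ) ^ ((l : ℝ) / 2)) *
      (2 * (2 : ℝ) ^ ((i : ℝ) / 2))) ≤ 8 * modWt i k := by
  have hll : (2 : ℝ) ^ (-(l : ℝ)) * ((2 : ℝ) ^ ((l : ℝ) / 2) * (2 : ℝ) ^ ((l : ℝ) / 2)) = 1 := by
    rw [← Real.rpow_add (by norm_num), ← Real.rpow_add (by norm_num)]
    ring_nf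
    simp
  have hi := two_rpow_le_modWt i k
  calc _ ≤ (2 * (2 : ℝ) ^ ((l : ℝ) / 2)) * ((2 : ℝ) ^ (-(l : ℝ)) *
        (2 * (2 : ℝ) ^ ((l : ℝ) / 2)) * (2 * (2 : ℝ) ^ ((i : ℝ) / 2))) := by
        gcongr
        exact modWt_self_le h
    _ = 8 * ((2 : ℝ) ^ (-(l : ℝ)) * ((2 : ℝ) ^ ((l : ℝ) / 2) * (2 : ℝ) ^ ((l : ℝ) / 2))) *
        (2 : ℝ) ^ ((i : ℝ) / 2) := by ring
    _ ≤ 8 * 1 * modWt i k := by rw [hll]; gcongr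
    _ = _ := by ring

end Weights

section Modulation

variable {η₀ : ℝ → ℝ}

/-- The modulus of the `j`-th modulation cutoff centred at `m`. -/
def modCut (η₀ : ℝ → ℝ) (j : ℕ) (m τ : ℝ) : ℝ≥0∞ := ‖chi η₀ j (τ - m)‖ₑ

lemma measurable_modCut (hη : BumpFun η₀) (j : ℕ) (m : ℝ) : Measurable (modCut η₀ j m) := by
  have := measurable_chi hη j
  unfold modCut
  fun_prop

lemma enorm_le_one_of_abs {x : ℝ} (h : |x| ≤ 1) : ‖x‖ₑ ≤ 1 := by
  rw [Real.enorm_eq_ofReal_abs]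
  exact ENNReal.ofReal_le_one.2 h

lemma modCut_le_one (hη : BumpFun η₀) (j : ℕ) (m τ : ℝ) : modCut η₀ j m τ ≤ 1 :=
  enorm_le_one_of_abs (abs_chi_le_one hη _ _)

lemma abs_sub_le_of_modCut (hη : BumpFun η₀) {j : ℕ} {m τ : ℝ} (h : modCut η₀ j m τ ≠ 0) :
    |τ - m| ≤ 2 ^ (j + 1) :=
  abs_le_of_chi_ne_zero hη (by simpa [modCut] using h)

lemma modCut_eq_zero (hη : BumpFun η₀) (j : ℕ) (m : ℝ) {τ : ℝ}
    (h : τ ∉ Metric.closedBall m (2 ^ (j + 1))) : modCut η₀ j m τ = 0 := by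
  by_contra h0
  exact h (by simpa [Metric.mem_closedBall, Real.dist_eq] using abs_sub_le_of_modCut hη h0)

lemma volume_closedBall_two_pow (m : ℝ) (j : ℕ) :
    volume (Metric.closedBall m (2 ^ (j + 1))) =
      ENNReal.ofReal (2 * (2 : ℝ) ^ ((j : ℝ) / 2)) ^ 2 := by
  rw [Real.volume_closedBall, ← ENNReal.ofReal_pow (by positivity), mul_pow,
    ← Real.rpow_mul_natCast (by norm_num)]
  congr 1
  have : (j : ℝ) / 2 * ((2 : ℕ) : ℝ) = j := by push_cast; ring
  rw [this, Real.rpow_natCast]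
  ring

/-- The norm of the `(i, j)` block of convolution with `kerL l` in the modulation decomposition. -/
def blockBound (l i j : ℕ) : ℝ≥0∞ :=
  if j ≤ i + 2 then kerMass else
    ENNReal.ofReal ((2 : ℝ) ^ (-(l : ℝ)) / (1 + (2 : ℝ) ^ (-(l : ℝ)) * (2 ^ j / 4)) ^ 4 *
      (2 * (2 : ℝ) ^ ((j : ℝ) / 2)) * (2 * (2 : ℝ) ^ ((i : ℝ) / 2)))

lemma lTwo_modCut_convK_le (hη : BumpFun η₀) (l i j : ℕ) (m : ℝ) {g : ℝ → ℝ≥0∞}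
    (hg : Measurable g) :
    lTwo volume (fun τ => modCut η₀ j m τ *
        convK (kerL l) (fun τ' => modCut η₀ i m τ' * g τ') τ) ≤
      blockBound l i j * lTwo volume (fun τ => modCut η₀ i m τ * g τ) := by
  have hig : Measurable fun τ => modCut η₀ i m τ * g τ := (measurable_modCut hη i m).mul hg
  unfold blockBound
  split_ifs with hij
  · rw [← lintegral_kerL l]
    exact (lTwo_mono fun τ => mul_le_of_le_one_left' (modCut_le_one hη j m τ)).trans
      (lTwo_convK_le (measurable_kerL l) hig)
  · rw [ENNReal.ofReal_mul (by positivity), ENNReal.ofReal_mul (by positivity)]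
    refine lTwo_mul_convK_le hig Metric.isClosed_closedBall.measurableSet
      Metric.isClosed_closedBall.measurableSet (modCut_le_one hη j m)
      (fun τ => modCut_eq_zero hη j m)
      (fun τ hτ => by rw [modCut_eq_zero hη i m hτ, zero_mul]) ?_
      (volume_closedBall_two_pow m j).le (volume_closedBall_two_pow m i).le
    intro τ hτ τ' hτ'
    apply kerL_le (by positivity)
    obtain ⟨p, rfl⟩ : ∃ p, j = i + 3 + p := ⟨j - (i + 3), by omega⟩
    have h1 : (2 : ℝ) ^ (i + 2 + p) ≤ |τ - m| :=
      le_abs_of_chi_succ_ne_zero (j := i + 2 + p) hη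
        (by have : i + 2 + p + 1 = i + 3 + p := by ring
            rw [this]; simpa [modCut] using hτ)
    have h2 := abs_sub_le_of_modCut hη (left_ne_zero_of_mul hτ')
    have h3 : (2 : ℝ) ^ (i + 1) ≤ 2 ^ (i + 1 + p) :=
      pow_le_pow_right₀ (by norm_num) (by omega)
    have h4 : |τ - m| ≤ |τ - τ'| + |τ' - m| := by
      simpa using abs_add_le (τ - τ') (τ' - m)
    have h5 : (2 : ℝ) ^ (i + 2 + p) = 2 * 2 ^ (i + 1 + p) := by ring
    have h6 : (2 : ℝ) ^ (i + 3 + p) / 4 = 2 ^ (i + 1 + p) := by ring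
    linarith

lemma ofReal_modWt_mul_blockBound_le {k l : ℕ} (h : l ≤ 5 * k) (i j : ℕ) :
    ENNReal.ofReal (modWt j k) * blockBound l i j ≤
      (8 * kerMass * ENNReal.ofReal (geomWt ((j : ℤ) - i)) +
        2048 * ENNReal.ofReal (geomWt ((j : ℤ) - l))) * ENNReal.ofReal (modWt i k) := by
  have hi := (modWt_pos i k).le
  unfold blockBound
  split_ifs with hij
  · have h1 := ENNReal.ofReal_le_ofReal (modWt_le_geomWt hij k)
    rw [ENNReal.ofReal_mul (by positivity), ENNReal.ofReal_mul (by positivity),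
      ENNReal.ofReal_ofNat] at h1
    calc _ ≤ _ := mul_le_mul_left h1 _
      _ = 8 * kerMass * ENNReal.ofReal (geomWt ((j : ℤ) - i)) * ENNReal.ofReal (modWt i k) := by
        ring
      _ ≤ _ := by gcongr; exact le_self_add
  · have h1 := ENNReal.ofReal_le_ofReal (modWt_mul_decay_le h i j)
    rw [ENNReal.ofReal_mul (modWt_pos j k).le, ENNReal.ofReal_mul (p := 2048 * _) (by positivity),
      ENNReal.ofReal_mul (p := 2048) (by positivity), ENNReal.ofReal_ofNat] at h1
    calc _ ≤ _ := h1
      _ = 2048 * ENNReal.ofReal (geomWt ((j : ℤ) - l)) * ENNReal.ofReal (modWt i k) := by ring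
      _ ≤ _ := by gcongr; exact le_add_self

/-- The modulus of the cutoff to modulations `≲ 2^l` centred at `m`. -/
def modCutLe (η₀ : ℝ → ℝ) (l : ℕ) (m τ : ℝ) : ℝ≥0∞ := ‖chiLe η₀ l (τ - m)‖ₑ

lemma measurable_modCutLe (hη : BumpFun η₀) (l : ℕ) (m : ℝ) : Measurable (modCutLe η₀ l m) := by
  have := hη.smooth.continuous.measurable
  unfold modCutLe
  simp only [chiLe_eq]
  fun_prop

lemma modCutLe_le_one (hη : BumpFun η₀) (l : ℕ) (m τ : ℝ) : modCutLe η₀ l m τ ≤ 1 := by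
  apply enorm_le_one_of_abs
  rw [chiLe_eq]
  have := hη.mem ((τ - m) / 2 ^ l)
  exact abs_le.2 ⟨by linarith [this.1], this.2⟩

lemma modCutLe_eq_zero (hη : BumpFun η₀) (l : ℕ) (m : ℝ) {τ : ℝ}
    (h : τ ∉ Metric.closedBall m (2 ^ (l + 1))) : modCutLe η₀ l m τ = 0 := by
  rw [modCutLe, chiLe_eq, hη.div_pow_eq_zero, enorm_zero]
  simpa [Metric.mem_closedBall, Real.dist_eq] using h

/-- The norm of convolution with `kerL l` from the `i`-th modulation piece to low modulations. -/
def lowBound (l i : ℕ) : ℝ≥0∞ :=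
  if l ≤ i then kerMass else
    ENNReal.ofReal ((2 : ℝ) ^ (-(l : ℝ)) * (2 * (2 : ℝ) ^ ((l : ℝ) / 2)) *
      (2 * (2 : ℝ) ^ ((i : ℝ) / 2)))

lemma lTwo_modCutLe_convK_le (hη : BumpFun η₀) (l i : ℕ) (m : ℝ) {g : ℝ → ℝ≥0∞}
    (hg : Measurable g) :
    lTwo volume (fun τ => modCutLe η₀ l m τ *
        convK (kerL l) (fun τ' => modCut η₀ i m τ' * g τ') τ) ≤
      lowBound l i * lTwo volume (fun τ => modCut η₀ i m τ * g τ) := by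
  have hig : Measurable fun τ => modCut η₀ i m τ * g τ := (measurable_modCut hη i m).mul hg
  unfold lowBound
  split_ifs with hij
  · rw [← lintegral_kerL l]
    exact (lTwo_mono fun τ => mul_le_of_le_one_left' (modCutLe_le_one hη l m τ)).trans
      (lTwo_convK_le (measurable_kerL l) hig)
  · rw [ENNReal.ofReal_mul (by positivity), ENNReal.ofReal_mul (by positivity)]
    refine lTwo_mul_convK_le hig Metric.isClosed_closedBall.measurableSet
      Metric.isClosed_closedBall.measurableSet (modCutLe_le_one hη l m)
      (fun τ => modCutLe_eq_zero hη l m)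
      (fun τ hτ => by rw [modCut_eq_zero hη i m hτ, zero_mul]) ?_
      (volume_closedBall_two_pow m l).le (volume_closedBall_two_pow m i).le
    intro τ _ τ' _
    simpa using kerL_le (l := l) le_rfl (abs_nonneg (τ - τ'))

lemma ofReal_modWt_mul_lowBound_le {k l : ℕ} (h : l ≤ 5 * k) (i : ℕ) :
    ENNReal.ofReal (modWt l k) * lowBound l i ≤ (kerMass + 8) * ENNReal.ofReal (modWt i k) := by
  unfold lowBound
  split_ifs with hij
  · calc _ ≤ ENNReal.ofReal (modWt i k) * kerMass := by
          gcongr; exact modWt_mono hij k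
      _ = kerMass * ENNReal.ofReal (modWt i k) := mul_comm _ _
      _ ≤ _ := by gcongr; exact le_self_add
  · rw [← ENNReal.ofReal_mul (modWt_pos l k).le]
    calc _ ≤ _ := ENNReal.ofReal_le_ofReal (modWt_self_mul_le h i)
      _ = 8 * ENNReal.ofReal (modWt i k) := by
        rw [ENNReal.ofReal_mul (by norm_num), ENNReal.ofReal_ofNat]
      _ ≤ _ := by gcongr; exact le_add_self

end Modulation

/-- The `L²(ℝ×ℤ)` norm of an `ℝ≥0∞`-valued function. -/
def lTwoZ (F : ℝ → ℤ → ℝ≥0∞) : ℝ≥0∞ :=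
  lTwo ((volume : Measure ℝ).prod (Measure.count : Measure ℤ)) (Function.uncurry F)

lemma measurable_uncurry_int {β : Type*} [MeasurableSpace β] {F : ℝ → ℤ → β}
    (h : ∀ n, Measurable fun τ => F τ n) : Measurable (Function.uncurry F) :=
  measurable_from_prod_countable_left h

lemma lTwoZ_sq {F : ℝ → ℤ → ℝ≥0∞} (hF : ∀ n, Measurable fun τ => F τ n) :
    lTwoZ F ^ 2 = ∑' n, lTwo volume (fun τ => F τ n) ^ 2 := by
  have hm : Measurable (Function.uncurry F) := measurable_uncurry_int hF
  simp only [lTwoZ, lTwo_sq]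
  rw [lintegral_prod_symm _ (hm.pow_const 2).aemeasurable, lintegral_count]
  rfl

lemma lTwoZ_sq' {F : ℝ → ℤ → ℝ≥0∞} (hF : ∀ n, Measurable fun τ => F τ n) :
    lTwoZ F ^ 2 = ∫⁻ τ, ∑' n, F τ n ^ 2 := by
  have hm : Measurable (Function.uncurry F) := measurable_uncurry_int hF
  simp only [lTwoZ, lTwo_sq]
  rw [lintegral_prod _ (hm.pow_const 2).aemeasurable]
  simp only [lintegral_count, Function.uncurry]

lemma lTwoZ_le_mul {F G : ℝ → ℤ → ℝ≥0∞} (hF : ∀ n, Measurable fun τ => F τ n)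
    (hG : ∀ n, Measurable fun τ => G τ n) {M : ℝ≥0∞}
    (h : ∀ n, lTwo volume (fun τ => F τ n) ≤ M * lTwo volume (fun τ => G τ n)) :
    lTwoZ F ≤ M * lTwoZ G := by
  refine (ENNReal.pow_le_pow_left_iff two_ne_zero).1 ?_
  rw [mul_pow, lTwoZ_sq hF, lTwoZ_sq hG, ← ENNReal.tsum_mul_left]
  refine ENNReal.tsum_le_tsum fun n => ?_
  rw [← mul_pow]
  gcongr
  exact h n

section Assembly

variable {η₀ : ℝ → ℝ}

/-- The `X_k` norm of an `ℝ≥0∞`-valued function, with dispersion relation `μ`. -/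
def xNorm (η₀ : ℝ → ℝ) (μ : ℤ → ℝ) (k : ℕ) (F : ℝ → ℤ → ℝ≥0∞) : ℝ≥0∞ :=
  ∑' j : ℕ, ENNReal.ofReal (modWt j k) * lTwoZ fun τ n => modCut η₀ j (μ n) τ * F τ n

lemma le_tsum_modCut_mul (hη : BumpFun η₀) (m τ : ℝ) (c : ℝ≥0∞) :
    c ≤ ∑' i, modCut η₀ i m τ * c := by
  rw [ENNReal.tsum_mul_right]
  exact le_mul_of_one_le_left' (one_le_tsum_chi hη (τ - m))

lemma convK_le_tsum (hη : BumpFun η₀) (m : ℝ) {K g : ℝ → ℝ≥0∞} (hK : Measurable K)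
    (hg : Measurable g) (τ : ℝ) :
    convK K g τ ≤ ∑' i, convK K (fun τ' => modCut η₀ i m τ' * g τ') τ := by
  unfold convK
  rw [← lintegral_tsum]
  · refine lintegral_mono fun τ' => ?_
    rw [ENNReal.tsum_mul_right]
    gcongr
    exact le_tsum_modCut_mul hη m τ' (g τ')
  · intro i
    have := measurable_modCut hη i m
    fun_prop

lemma lTwoZ_mul_convK_le (hη : BumpFun η₀) (μ : ℤ → ℝ) {K : ℝ → ℝ≥0∞} (hK : Measurable K)
    {A : ℝ → ℤ → ℝ≥0∞} (hA : ∀ n, Measurable fun τ => A τ n) {M : ℕ → ℝ≥0∞}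
    (hM : ∀ (i : ℕ) (n : ℤ) (g : ℝ → ℝ≥0∞), Measurable g →
      lTwo volume (fun τ => A τ n * convK K (fun τ' => modCut η₀ i (μ n) τ' * g τ') τ) ≤
        M i * lTwo volume (fun τ => modCut η₀ i (μ n) τ * g τ))
    {F : ℝ → ℤ → ℝ≥0∞} (hF : ∀ n, Measurable fun τ => F τ n) :
    lTwoZ (fun τ n => A τ n * convK K (fun τ' => F τ' n) τ) ≤
      ∑' i, M i * lTwoZ fun τ n => modCut η₀ i (μ n) τ * F τ n := by
  have hFi : ∀ i n, Measurable fun τ => modCut η₀ i (μ n) τ * F τ n :=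
    fun i n => (measurable_modCut hη i (μ n)).mul (hF n)
  have hTi : ∀ i n, Measurable fun τ =>
      A τ n * convK K (fun τ' => modCut η₀ i (μ n) τ' * F τ' n) τ :=
    fun i n => (hA n).mul (measurable_convK hK (hFi i n))
  calc _ ≤ lTwoZ (fun τ n =>
        ∑' i, A τ n * convK K (fun τ' => modCut η₀ i (μ n) τ' * F τ' n) τ) := by
        refine lTwo_mono fun p => ?_
        simp only [Function.uncurry]
        rw [ENNReal.tsum_mul_left]
        gcongr
        exact convK_le_tsum hη (μ p.2) hK (hF p.2) p.1
    _ ≤ ∑' i, lTwoZ (fun τ n =>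
        A τ n * convK K (fun τ' => modCut η₀ i (μ n) τ' * F τ' n) τ) :=
        lTwo_tsum_le fun i => measurable_uncurry_int (hTi i)
    _ ≤ _ := by
        gcongr with i
        exact lTwoZ_le_mul (hTi i) (hFi i) fun n => hM i n _ (hF n)

/-- Convolution with `kerL l` is bounded on `X_k`. -/
lemma xNorm_convK_le (hη : BumpFun η₀) (μ : ℤ → ℝ) {k l : ℕ} (h : l ≤ 5 * k)
    {F : ℝ → ℤ → ℝ≥0∞} (hF : ∀ n, Measurable fun τ => F τ n) :
    xNorm η₀ μ k (fun τ n => convK (kerL l) (fun τ' => F τ' n) τ) ≤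
      (8 * kerMass * geomSum + 2048 * geomSum) * xNorm η₀ μ k F := by
  unfold xNorm
  set B : ℕ → ℝ≥0∞ := fun i => lTwoZ fun τ n => modCut η₀ i (μ n) τ * F τ n with hB
  calc _ ≤ ∑' j, ENNReal.ofReal (modWt j k) * ∑' i, blockBound l i j * B i := by
        gcongr with j
        exact lTwoZ_mul_convK_le hη μ (measurable_kerL l)
          (fun n => measurable_modCut hη j (μ n))
          (fun i n g hg => lTwo_modCut_convK_le hη l i j (μ n) hg) hF
    _ = ∑' i, ∑' j, ENNReal.ofReal (modWt j k) * blockBound l i j * B i := by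
        rw [ENNReal.tsum_comm]
        simp only [← ENNReal.tsum_mul_left, mul_assoc]
    _ ≤ ∑' (i : ℕ) (j : ℕ), (8 * kerMass * ENNReal.ofReal (geomWt ((j : ℤ) - i)) +
        2048 * ENNReal.ofReal (geomWt ((j : ℤ) - l))) * ENNReal.ofReal (modWt i k) * B i := by
        exact ENNReal.tsum_le_tsum fun i => ENNReal.tsum_le_tsum fun j =>
          mul_le_mul_left (ofReal_modWt_mul_blockBound_le h i j) _
    _ = ∑' i : ℕ, (8 * kerMass * (∑' j : ℕ, ENNReal.ofReal (geomWt ((j : ℤ) - i))) +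
        2048 * ∑' j : ℕ, ENNReal.ofReal (geomWt ((j : ℤ) - l))) *
          (ENNReal.ofReal (modWt i k) * B i) := by
        congr 1; ext i
        rw [← ENNReal.tsum_mul_left, ← ENNReal.tsum_mul_left, ← ENNReal.tsum_add,
          ← ENNReal.tsum_mul_right]
        simp only [mul_assoc]
    _ ≤ ∑' i : ℕ, (8 * kerMass * geomSum + 2048 * geomSum) *
          (ENNReal.ofReal (modWt i k) * B i) := by
        gcongr with i
        · exact tsum_geomWt_le i
        · exact tsum_geomWt_le l
    _ = _ := ENNReal.tsum_mul_left

lemma lTwoZ_modCutLe_convK_le (hη : BumpFun η₀) (μ : ℤ → ℝ) {k l : ℕ} (h : l ≤ 5 * k)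
    {F : ℝ → ℤ → ℝ≥0∞} (hF : ∀ n, Measurable fun τ => F τ n) :
    ENNReal.ofReal (modWt l k) *
        lTwoZ (fun τ n => modCutLe η₀ l (μ n) τ * convK (kerL l) (fun τ' => F τ' n) τ) ≤
      (kerMass + 8) * xNorm η₀ μ k F := by
  unfold xNorm
  calc _ ≤ ENNReal.ofReal (modWt l k) *
        ∑' i, lowBound l i * lTwoZ fun τ n => modCut η₀ i (μ n) τ * F τ n := by
        gcongr
        exact lTwoZ_mul_convK_le hη μ (measurable_kerL l)
          (fun n => measurable_modCutLe hη l (μ n))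
          (fun i n g hg => lTwo_modCutLe_convK_le hη l i (μ n) hg) hF
    _ ≤ _ := by
        rw [← ENNReal.tsum_mul_left, ← ENNReal.tsum_mul_left]
        refine ENNReal.tsum_le_tsum fun i => ?_
        rw [← mul_assoc, ← mul_assoc]
        exact mul_le_mul_left (ofReal_modWt_mul_lowBound_le h i) _

/-- The trace bound `‖∫ F dτ‖_{ℓ²} ≤ 2 ‖F‖_{X_k}`. -/
lemma lTwo_lintegral_le (hη : BumpFun η₀) (μ : ℤ → ℝ) (k : ℕ)
    {F : ℝ → ℤ → ℝ≥0∞} (hF : ∀ n, Measurable fun τ => F τ n) :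
    lTwo Measure.count (fun n => ∫⁻ τ, F τ n) ≤ 2 * xNorm η₀ μ k F := by
  have hFi : ∀ i n, Measurable fun τ => modCut η₀ i (μ n) τ * F τ n :=
    fun i n => (measurable_modCut hη i (μ n)).mul (hF n)
  calc _ ≤ lTwo Measure.count (fun n => ∑' i, ∫⁻ τ, modCut η₀ i (μ n) τ * F τ n) := by
        refine lTwo_mono fun n => ?_
        rw [← lintegral_tsum fun i => (hFi i n).aemeasurable]
        exact lintegral_mono fun τ => le_tsum_modCut_mul hη (μ n) τ _
    _ ≤ ∑' i, lTwo Measure.count (fun n => ∫⁻ τ, modCut η₀ i (μ n) τ * F τ n) :=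
        lTwo_tsum_le fun i => measurable_of_countable _
    _ ≤ ∑' i, 2 * (ENNReal.ofReal (modWt i k) *
          lTwoZ fun τ n => modCut η₀ i (μ n) τ * F τ n) := by
        refine ENNReal.tsum_le_tsum fun i => ?_
        rw [← mul_assoc]
        calc _ ≤ ENNReal.ofReal (2 * (2 : ℝ) ^ ((i : ℝ) / 2)) *
              lTwoZ fun τ n => modCut η₀ i (μ n) τ * F τ n := by
              apply lTwo_le_of_sq
              rw [lintegral_count, mul_pow, lTwoZ_sq (hFi i), ← ENNReal.tsum_mul_left]
              refine ENNReal.tsum_le_tsum fun n => ?_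
              rw [lTwo_sq, ← volume_closedBall_two_pow (μ n) i]
              exact sq_lintegral_le_of_support (hFi i n)
                Metric.isClosed_closedBall.measurableSet
                fun τ hτ => by rw [modCut_eq_zero hη i (μ n) hτ, zero_mul]
          _ ≤ _ := by
              gcongr
              rw [ENNReal.ofReal_mul (by norm_num), ENNReal.ofReal_ofNat]
              gcongr
              exact two_rpow_le_modWt i k
    _ = _ := by rw [ENNReal.tsum_mul_left]; rfl

end Assembly

section Bridge

variable {η₀ : ℝ → ℝ}

lemma ofReal_tsum_le {ι : Type*} {a : ι → ℝ} (ha : ∀ i, 0 ≤ a i) :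
    ENNReal.ofReal (∑' i, a i) ≤ ∑' i, ENNReal.ofReal (a i) := by
  by_cases h : Summable a
  · rw [ENNReal.ofReal_tsum_of_nonneg ha h]
  · simp [tsum_eq_zero_of_not_summable h]

lemma ofReal_integral_le {α : Type*} [MeasurableSpace α] {μ : Measure α} {h : α → ℝ}
    (hh : ∀ a, 0 ≤ h a) : ENNReal.ofReal (∫ a, h a ∂μ) ≤ ∫⁻ a, ENNReal.ofReal (h a) ∂μ := by
  by_cases hi : Integrable h μ
  · rw [ofReal_integral_eq_lintegral_ofReal hi (Filter.Eventually.of_forall hh)]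
  · simp [integral_undef hi]

lemma ofReal_sqrt (x : ℝ) : ENNReal.ofReal (Real.sqrt x) = ENNReal.ofReal x ^ (1 / 2 : ℝ) := by
  rcases le_total 0 x with h | h
  · rw [Real.sqrt_eq_rpow, ENNReal.ofReal_rpow_of_nonneg h (by norm_num)]
  · simp [Real.sqrt_eq_zero_of_nonpos h, ENNReal.ofReal_of_nonpos h]

lemma enorm_ofReal_complex (x : ℝ) : ‖(x : ℂ)‖ₑ = ‖x‖ₑ := by
  rw [← ofReal_norm, Complex.norm_real, ofReal_norm]

lemma ofReal_norm_sq (z : ℂ) : ENNReal.ofReal (‖z‖ ^ 2) = ‖z‖ₑ ^ 2 := by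
  rw [ENNReal.ofReal_pow (norm_nonneg _), ofReal_norm]

lemma ofReal_l2l2_le {G : ℝ → ℤ → ℂ} {H : ℝ → ℤ → ℝ≥0∞} (hH : ∀ n, Measurable fun τ => H τ n)
    (h : ∀ τ n, ‖G τ n‖ₑ ≤ H τ n) : ENNReal.ofReal (l2l2 G) ≤ lTwoZ H := by
  rw [l2l2, ofReal_sqrt, ← sq_rpow_half (lTwoZ H), lTwoZ_sq' hH]
  gcongr
  refine (ofReal_integral_le fun τ => tsum_nonneg fun n => by positivity).trans
    (lintegral_mono fun τ => (ofReal_tsum_le fun n => by positivity).trans ?_)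
  refine ENNReal.tsum_le_tsum fun n => ?_
  rw [ofReal_norm_sq]
  gcongr
  exact h τ n

lemma l2l2_nonneg (G : ℝ → ℤ → ℂ) : 0 ≤ l2l2 G := Real.sqrt_nonneg _

lemma finite_IkR (k : ℕ) : {n : ℤ | (n : ℝ) ∈ IkR k}.Finite := by
  refine (Set.finite_Icc (-(2 ^ (k + 1) : ℤ)) (2 ^ (k + 1))).subset fun n hn => ?_
  have h : |(n : ℝ)| ≤ 2 ^ (k + 1) := by
    simp only [IkR, Set.mem_ofPred_eq] at hn
    split_ifs at hn with hk
    · subst hk; simpa using hn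
    · exact hn.2
  exact abs_le.1 (by exact_mod_cast h)

lemma lTwoZ_eq_ofReal_l2l2 {G : ℝ → ℤ → ℂ} {S : Set ℤ} (hS : S.Finite)
    (hG : ∀ n, Measurable fun τ => G τ n) (hsupp : ∀ τ, ∀ n ∉ S, G τ n = 0)
    (hInteg : Integrable fun τ => ∑' n, ‖G τ n‖ ^ 2) :
    lTwoZ (fun τ n => ‖G τ n‖ₑ) = ENNReal.ofReal (l2l2 G) := by
  rw [l2l2, ofReal_sqrt, ← sq_rpow_half (lTwoZ _), lTwoZ_sq' fun n => (hG n).enorm,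
    ofReal_integral_eq_lintegral_ofReal hInteg
      (Filter.Eventually.of_forall fun τ => tsum_nonneg fun n => by positivity)]
  congr 1
  refine lintegral_congr fun τ => ?_
  rw [ENNReal.ofReal_tsum_of_nonneg (fun n => by positivity)]
  · simp only [ofReal_norm_sq]
  · exact summable_of_hasFiniteSupport (hS.subset fun n hn => by
      by_contra h
      exact hn (by simp [hsupp τ n h]))

lemma ofReal_Xnorm_le (hη : BumpFun η₀) (d₁ d₂ : ℝ) (k : ℕ) {G : ℝ → ℤ → ℂ}
    {H : ℝ → ℤ → ℝ≥0∞} (hH : ∀ n, Measurable fun τ => H τ n) (h : ∀ τ n, ‖G τ n‖ₑ ≤ H τ n) :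
    ENNReal.ofReal (Xnorm η₀ d₁ d₂ k G) ≤ xNorm η₀ (muPhase d₁ d₂) k H := by
  refine (ofReal_tsum_le fun j => mul_nonneg (modWt_pos j k).le (l2l2_nonneg _)).trans ?_
  refine ENNReal.tsum_le_tsum fun j => ?_
  rw [ENNReal.ofReal_mul (modWt_pos j k).le]
  refine mul_le_mul_right (ofReal_l2l2_le (fun n => (measurable_modCut hη j _).mul (hH n)) ?_) _
  intro τ n
  rw [enorm_mul, enorm_ofReal_complex]
  exact mul_le_mul_right (h τ n) _

lemma xNorm_enorm_eq (hη : BumpFun η₀) {d₁ d₂ : ℝ} {k : ℕ} {f : ℝ → ℤ → ℂ}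
    (hsupp : ∀ τ : ℝ, ∀ n : ℤ, f τ n ≠ 0 → (n : ℝ) ∈ IkR k) (hf : XFinite η₀ d₁ d₂ k f) :
    xNorm η₀ (muPhase d₁ d₂) k (fun τ n => ‖f τ n‖ₑ) =
      ENNReal.ofReal (Xnorm η₀ d₁ d₂ k f) := by
  obtain ⟨hmeas, hInteg, hsum⟩ := hf
  change Summable fun j => modWt j k * _ at hsum
  have hX : Xnorm η₀ d₁ d₂ k f = ∑' j, modWt j k *
      l2l2 fun τ n => ((chi η₀ j (τ - muPhase d₁ d₂ n) : ℝ) : ℂ) * f τ n := rfl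
  rw [hX, ENNReal.ofReal_tsum_of_nonneg
    (fun j => mul_nonneg (modWt_pos j k).le (l2l2_nonneg _)) hsum]
  unfold xNorm
  congr 1; ext j
  rw [ENNReal.ofReal_mul (modWt_pos j k).le, ← lTwoZ_eq_ofReal_l2l2 (finite_IkR k) _ _
    (hInteg j)]
  · congr; ext τ n
    rw [enorm_mul, enorm_ofReal_complex, modCut]
  · intro n
    have h1 := measurable_chi hη j
    have h2 : Measurable fun τ => f τ n := hmeas.comp measurable_prodMk_right
    fun_prop
  · intro τ n hn
    have : f τ n = 0 := by_contra fun h => hn (hsupp τ n h)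
    simp [this]

lemma le_mul_of_ofReal_le {A X : ℝ} {C : ℝ≥0∞} (hC : C ≠ ∞) (hX : 0 ≤ X)
    (h : ENNReal.ofReal A ≤ C * ENNReal.ofReal X) : A ≤ (C.toReal + 1) * X := by
  rw [← ENNReal.ofReal_toReal hC, ← ENNReal.ofReal_mul ENNReal.toReal_nonneg] at h
  have := (ENNReal.ofReal_le_ofReal_iff (by positivity)).1 h
  linarith

lemma Xnorm_nonneg (d₁ d₂ : ℝ) (k : ℕ) (f : ℝ → ℤ → ℂ) : 0 ≤ Xnorm η₀ d₁ d₂ k f :=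
  tsum_nonneg fun j => mul_nonneg (modWt_pos j k).le (l2l2_nonneg _)

lemma enorm_integral_kerL_le (f : ℝ → ℤ → ℂ) (l : ℕ) (τ : ℝ) (n : ℤ) :
    ‖((∫ τ' : ℝ, ‖f τ' n‖ * (2 : ℝ) ^ (-(l : ℝ)) /
      (1 + (2 : ℝ) ^ (-(l : ℝ)) * |τ - τ'|) ^ 4 : ℝ) : ℂ)‖ₑ ≤
      convK (kerL l) (fun τ' => ‖f τ' n‖ₑ) τ := by
  rw [enorm_ofReal_complex]
  refine (enorm_integral_le_lintegral_enorm _).trans (lintegral_mono fun τ' => le_of_eq ?_)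
  rw [mul_div_assoc, enorm_mul, enorm_norm, kerL, Real.enorm_eq_ofReal (by positivity)]

lemma lTwo_const_mul {α : Type*} [MeasurableSpace α] {μ : Measure α} (c : ℝ≥0∞) {f : α → ℝ≥0∞}
    (hf : Measurable f) : lTwo μ (fun a => c * f a) = c * lTwo μ f := by
  simp only [lTwo, mul_pow]
  rw [lintegral_const_mul _ (hf.pow_const 2), ENNReal.mul_rpow_of_nonneg _ _ (by norm_num),
    sq_rpow_half]

lemma xNorm_const_mul (hη : BumpFun η₀) (μ : ℤ → ℝ) (k : ℕ) (c : ℝ≥0∞) {F : ℝ → ℤ → ℝ≥0∞}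
    (hF : ∀ n, Measurable fun τ => F τ n) :
    xNorm η₀ μ k (fun τ n => c * F τ n) = c * xNorm η₀ μ k F := by
  simp only [xNorm]
  rw [← ENNReal.tsum_mul_left]
  congr 1; ext j
  have hm : Measurable (Function.uncurry fun τ n => modCut η₀ j (μ n) τ * F τ n) :=
    measurable_uncurry_int fun n => (measurable_modCut hη j (μ n)).mul (hF n)
  rw [mul_left_comm, lTwoZ, lTwoZ, ← lTwo_const_mul c hm]
  congr 2; ext p
  simp only [Function.uncurry]
  ring

end Bridge

section Multiplier

open FourierTransform

lemma exists_fourierIntegral_decay (γ : SchwartzMap ℝ ℝ) : ∃ C : ℝ, 0 ≤ C ∧ ∀ ω : ℝ,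
    ‖∫ s : ℝ, Complex.exp (-(I * (ω : ℂ) * (s : ℂ))) * (γ s : ℂ)‖ ≤ C / (1 + |ω|) ^ 4 := by
  let γc : SchwartzMap ℝ ℂ := SchwartzMap.postcompCLM (𝕜 := ℝ) Complex.ofRealCLM γ
  have hγc : ∀ s, γc s = (γ s : ℂ) := fun s => rfl
  obtain ⟨C, hC⟩ : ∃ C : ℝ, ∀ x, (1 + ‖x‖) ^ 4 * ‖(𝓕 γc) x‖ ≤ C :=
    ⟨_, fun x => by
      simpa using SchwartzMap.one_add_le_sup_seminorm_apply (𝕜 := ℝ) (m := (4, 0)) le_rfl le_rfl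
        (𝓕 γc) x⟩
  have hC0 : 0 ≤ C := le_trans (by positivity) (hC 0)
  have hπ : 1 ≤ 2 * Real.pi := by linarith [Real.pi_gt_three]
  refine ⟨(2 * Real.pi) ^ 4 * C, by positivity, fun ω => ?_⟩
  have h1 : ∫ s : ℝ, Complex.exp (-(I * (ω : ℂ) * (s : ℂ))) * (γ s : ℂ) =
      (𝓕 γc) (ω / (2 * Real.pi)) := by
    rw [SchwartzMap.fourier_coe, Real.fourier_eq']
    congr 1; ext s
    rw [hγc, smul_eq_mul]
    congr 2
    have : (Real.pi : ℂ) ≠ 0 := by exact_mod_cast Real.pi_ne_zero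
    simp
    field_simp
  rw [h1, le_div_iff₀ (by positivity)]
  have h2 := hC (ω / (2 * Real.pi))
  have h3 : 1 + |ω| ≤ 2 * Real.pi * (1 + ‖ω / (2 * Real.pi)‖) := by
    rw [Real.norm_eq_abs, abs_div, abs_of_pos (by positivity : 0 < 2 * Real.pi), mul_add,
      mul_div_cancel₀ _ (by positivity)]
    linarith
  calc _ ≤ ‖(𝓕 γc) (ω / (2 * Real.pi))‖ * (2 * Real.pi * (1 + ‖ω / (2 * Real.pi)‖)) ^ 4 := by
        gcongr
    _ = (2 * Real.pi) ^ 4 * ((1 + ‖ω / (2 * Real.pi)‖) ^ 4 * ‖(𝓕 γc) (ω / (2 * Real.pi))‖) := by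
        ring
    _ ≤ _ := by gcongr

lemma exists_fourierIntegral_kerL (γ : SchwartzMap ℝ ℝ) : ∃ C : ℝ, 0 ≤ C ∧ ∀ (l : ℕ) (t₀ σ : ℝ),
    ‖∫ t : ℝ, Complex.exp (-(I * (σ : ℂ) * (t : ℂ))) *
      ((γ ((2 : ℝ) ^ l * (t - t₀)) : ℝ) : ℂ)‖ₑ ≤ ENNReal.ofReal C * kerL l σ := by
  obtain ⟨C, hC0, hC⟩ := exists_fourierIntegral_decay γ
  refine ⟨C, hC0, fun l t₀ σ => ?_⟩
  have hp : (2 : ℝ) ^ (-(l : ℝ)) = ((2 : ℝ) ^ l)⁻¹ := by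
    rw [Real.rpow_neg (by norm_num), Real.rpow_natCast]
  set q : ℝ := ((2 : ℝ) ^ l)⁻¹ with hq
  have hq0 : 0 < q := by positivity
  have h2l : (2 : ℝ) ^ l = q⁻¹ := by rw [hq, inv_inv]
  have h1 : ∀ t : ℝ, Complex.exp (-(I * (σ : ℂ) * (t : ℂ))) *
      ((γ ((2 : ℝ) ^ l * (t - t₀)) : ℝ) : ℂ) = Complex.exp (-(I * (σ : ℂ) * (t₀ : ℂ))) *
        (fun s : ℝ => Complex.exp (-(I * ((q * σ : ℝ) : ℂ) * (s : ℂ))) * (γ s : ℂ))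
          (q⁻¹ * (t - t₀)) := fun t => by
    have hqc : (q : ℂ) ≠ 0 := by exact_mod_cast hq0.ne'
    simp only
    rw [h2l, ← mul_assoc, ← Complex.exp_add]
    congr 2
    push_cast
    field_simp
    ring
  simp only [h1]
  have h2 := Measure.integral_comp_mul_left (fun s : ℝ =>
    Complex.exp (-(I * ((q * σ : ℝ) : ℂ) * (s : ℂ))) * (γ s : ℂ)) q⁻¹
  rw [integral_const_mul, integral_sub_right_eq_self (fun t => (fun s : ℝ =>
    Complex.exp (-(I * ((q * σ : ℝ) : ℂ) * (s : ℂ))) * (γ s : ℂ)) (q⁻¹ * t)) t₀, h2, ← ofReal_norm, kerL, hp, ← ENNReal.ofReal_mul hC0]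
  apply ENNReal.ofReal_le_ofReal
  have hexp : ‖Complex.exp (-(I * (σ : ℂ) * (t₀ : ℂ)))‖ = 1 := by
    rw [Complex.norm_exp]; simp
  rw [norm_mul, hexp, one_mul, norm_smul, inv_inv, Real.norm_eq_abs, abs_abs, abs_of_pos hq0]
  calc _ ≤ q * (C / (1 + |q * σ|) ^ 4) := by gcongr; exact hC (q * σ)
    _ = _ := by rw [abs_mul, abs_of_pos hq0]; ring

lemma enorm_timeFT_mul_timeIFT_le {f : ℝ → ℤ → ℂ} {n : ℤ} (hf : Measurable fun τ => f τ n)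
    (hfi : ∫⁻ τ, ‖f τ n‖ₑ < ∞) {g : ℝ → ℝ} (hg : Integrable g) {C : ℝ≥0∞} {K : ℝ → ℝ≥0∞}
    (hK : Measurable K)
    (hgK : ∀ σ : ℝ, ‖∫ t : ℝ, Complex.exp (-(I * (σ : ℂ) * (t : ℂ))) * ((g t : ℝ) : ℂ)‖ₑ ≤
      C * K σ) (τ : ℝ) :
    ‖timeFT (fun t n => ((g t : ℝ) : ℂ) * timeIFT f t n) τ n‖ₑ ≤
      C * convK K (fun τ' => ‖f τ' n‖ₑ) τ := by
  have hF : Integrable fun τ => f τ n := ⟨hf.aestronglyMeasurable, hfi⟩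
  set c : ℂ := ((Real.sqrt (2 * Real.pi) : ℝ) : ℂ)⁻¹ with hc
  have hc1 : ‖c‖ₑ ≤ 1 := by
    rw [← ofReal_norm, hc, norm_inv, Complex.norm_real, Real.norm_of_nonneg (Real.sqrt_nonneg _)]
    refine ENNReal.ofReal_le_one.2 (inv_le_one_of_one_le₀ ?_)
    rw [Real.one_le_sqrt]
    linarith [Real.pi_gt_three]
  have hswap : timeFT (fun t n => ((g t : ℝ) : ℂ) * timeIFT f t n) τ n =
      c * c * ∫ τ' : ℝ, f τ' n *
        ∫ t : ℝ, Complex.exp (-(I * ((τ - τ' : ℝ) : ℂ) * (t : ℂ))) * ((g t : ℝ) : ℂ) := by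
    have hprod : Integrable (Function.uncurry fun (t τ' : ℝ) =>
        f τ' n * (Complex.exp (-(I * ((τ - τ' : ℝ) : ℂ) * (t : ℂ))) * ((g t : ℝ) : ℂ)))
        (volume.prod volume) := by
      have h0 : Integrable (fun p : ℝ × ℝ => ((g p.1 : ℝ) : ℂ) * f p.2 n)
          (volume.prod volume) := hg.ofReal.mul_prod hF
      refine (h0.bdd_mul (c := 1) (f := fun p : ℝ × ℝ =>
        Complex.exp (-(I * ((τ - p.2 : ℝ) : ℂ) * (p.1 : ℂ)))) ?_ ?_).congr ?_
      · exact Continuous.aestronglyMeasurable (by fun_prop)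
      · refine Filter.Eventually.of_forall fun p => ?_
        rw [Complex.norm_exp]; simp
      · refine Filter.Eventually.of_forall fun p => ?_
        simp only [Function.uncurry]
        ring
    have h1 : ∀ t : ℝ, Complex.exp (-(I * (τ : ℂ) * (t : ℂ))) * (((g t : ℝ) : ℂ) *
        (c * ∫ τ' : ℝ, Complex.exp (I * (τ' : ℂ) * (t : ℂ)) * f τ' n)) =
        c * ∫ τ' : ℝ, f τ' n *
          (Complex.exp (-(I * ((τ - τ' : ℝ) : ℂ) * (t : ℂ))) * ((g t : ℝ) : ℂ)) := fun t => by
      have h2 : ∀ τ' : ℝ, f τ' n *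
          (Complex.exp (-(I * ((τ - τ' : ℝ) : ℂ) * (t : ℂ))) * ((g t : ℝ) : ℂ)) =
          (Complex.exp (-(I * (τ : ℂ) * (t : ℂ))) * ((g t : ℝ) : ℂ)) *
            (Complex.exp (I * (τ' : ℂ) * (t : ℂ)) * f τ' n) := fun τ' => by
        have h3 : -(I * ((τ - τ' : ℝ) : ℂ) * (t : ℂ)) =
            -(I * (τ : ℂ) * (t : ℂ)) + I * (τ' : ℂ) * (t : ℂ) := by push_cast; ring
        rw [h3, Complex.exp_add]
        ring
      simp only [h2]
      rw [integral_const_mul]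
      ring
    simp only [timeFT, timeIFT, ← hc, h1]
    rw [integral_const_mul, integral_integral_swap hprod, mul_assoc]
    simp only [integral_const_mul]
  rw [hswap, enorm_mul, enorm_mul, convK, ← lintegral_const_mul _ (by fun_prop)]
  calc _ ≤ 1 * 1 * ∫⁻ τ', ‖f τ' n * ∫ t : ℝ,
        Complex.exp (-(I * ((τ - τ' : ℝ) : ℂ) * (t : ℂ))) * ((g t : ℝ) : ℂ)‖ₑ := by
        gcongr
        exact enorm_integral_le_lintegral_enorm _
    _ ≤ _ := by
        rw [one_mul, one_mul]
        refine lintegral_mono fun τ' => ?_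
        rw [enorm_mul, mul_left_comm]
        gcongr
        exact hgK _

end Multiplier

/-- **Properties of the spaces `X_k`** (Lemma 2.1): smoothing of `X_k` functions against
kernels concentrated at time scale `2^{-l}`, boundedness of time multipliers at scale
`2^{-l}` (`l ≤ 5k`), and the trace-type bound `‖∫|f_k(τ',n)|dτ'‖_{ℓ²_n} ≲ ‖f_k‖_{X_k}`. -/
theorem properties_of_Xk (η₀ : ℝ → ℝ) (hη : BumpFun η₀) :
    (∃ C > (0:ℝ), ∀ d₁ d₂ : ℝ, ∀ k l : ℕ, l ≤ 5 * k →
      ∀ f : ℝ → ℤ → ℂ,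
        (∀ τ : ℝ, ∀ n : ℤ, f τ n ≠ 0 → (n : ℝ) ∈ IkR k) →
        XFinite η₀ d₁ d₂ k f →
        ((∑' j : ℕ, if l + 1 ≤ j then
              (2 : ℝ) ^ ((j : ℝ) / 2) * betaWt j k *
                l2l2 (fun τ n => ((chi η₀ j (τ - muPhase d₁ d₂ n) : ℝ) : ℂ) *
                  ((∫ τ' : ℝ, ‖f τ' n‖ * (2 : ℝ) ^ (-(l : ℝ)) /
                      (1 + (2 : ℝ) ^ (-(l : ℝ)) * |τ - τ'|) ^ 4 : ℝ) : ℂ))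
            else 0) +
          (2 : ℝ) ^ ((l : ℝ) / 2) * betaWt l k *
            l2l2 (fun τ n => ((chiLe η₀ l (τ - muPhase d₁ d₂ n) : ℝ) : ℂ) *
              ((∫ τ' : ℝ, ‖f τ' n‖ * (2 : ℝ) ^ (-(l : ℝ)) /
                  (1 + (2 : ℝ) ^ (-(l : ℝ)) * |τ - τ'|) ^ 4 : ℝ) : ℂ)) ≤
          C * Xnorm η₀ d₁ d₂ k f) ∧
        Real.sqrt (∑' n : ℤ, (∫ τ' : ℝ, ‖f τ' n‖) ^ 2) ≤ C * Xnorm η₀ d₁ d₂ k f) ∧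
    (∀ γ : SchwartzMap ℝ ℝ, ∃ C > (0:ℝ), ∀ d₁ d₂ : ℝ, ∀ k l : ℕ, l ≤ 5 * k → ∀ t₀ : ℝ,
      ∀ f : ℝ → ℤ → ℂ,
        (∀ τ : ℝ, ∀ n : ℤ, f τ n ≠ 0 → (n : ℝ) ∈ IkR k) →
        XFinite η₀ d₁ d₂ k f →
        Xnorm η₀ d₁ d₂ k
            (timeFT fun t n => ((γ ((2 : ℝ) ^ (l : ℕ) * (t - t₀)) : ℝ) : ℂ) * timeIFT f t n) ≤
          C * Xnorm η₀ d₁ d₂ k f) := by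
  constructor
  · set C₁ : ℝ≥0∞ := 8 * kerMass * geomSum + 2048 * geomSum with hC₁
    set C : ℝ≥0∞ := C₁ + (kerMass + 8) + 2 with hC
    have hkm := kerMass_lt_top.ne
    have hgs := geomSum_lt_top.ne
    have hCtop : C ≠ ∞ := by
      simp only [hC, hC₁]
      finiteness
    refine ⟨C.toReal + 1, by positivity, fun d₁ d₂ k l hl f hsupp hf => ?_⟩
    have hfm : ∀ n, Measurable fun τ => ‖f τ n‖ₑ := fun n =>
      (hf.1.comp measurable_prodMk_right).enorm
    have hTm : ∀ n, Measurable (convK (kerL l) fun τ' => ‖f τ' n‖ₑ) := fun n =>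
      measurable_convK (measurable_kerL l) (hfm n)
    have hX := xNorm_enorm_eq hη hsupp hf
    have hX0 := Xnorm_nonneg (η₀ := η₀) d₁ d₂ k f
    constructor
    · refine le_mul_of_ofReal_le hCtop hX0 (ENNReal.ofReal_add_le.trans ?_)
      rw [← hX]
      refine le_trans (add_le_add (b := C₁ * _) (d := (kerMass + 8) * _) ?_ ?_)
        ((add_mul _ _ _).symm.trans_le (mul_le_mul_left le_self_add _))
      · refine le_trans ?_ (xNorm_convK_le hη (muPhase d₁ d₂) hl hfm)
        refine (ofReal_tsum_le fun j => ?_).trans (ENNReal.tsum_le_tsum fun j => ?_)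
        · split_ifs
          · exact mul_nonneg (modWt_pos j k).le (l2l2_nonneg _)
          · exact le_rfl
        · split_ifs
          · rw [← modWt, ENNReal.ofReal_mul (modWt_pos j k).le]
            refine mul_le_mul_right
              (ofReal_l2l2_le (fun n => (measurable_modCut hη j _).mul (hTm n)) ?_) _
            intro τ n
            rw [enorm_mul, enorm_ofReal_complex]
            exact mul_le_mul_right (enorm_integral_kerL_le f l τ n) _
          · simp
      · refine le_trans ?_ (lTwoZ_modCutLe_convK_le hη (muPhase d₁ d₂) hl hfm)
        rw [← modWt, ENNReal.ofReal_mul (modWt_pos l k).le]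
        refine mul_le_mul_right
          (ofReal_l2l2_le (fun n => (measurable_modCutLe hη l _).mul (hTm n)) ?_) _
        intro τ n
        rw [enorm_mul, enorm_ofReal_complex]
        exact mul_le_mul_right (enorm_integral_kerL_le f l τ n) _
    · refine le_mul_of_ofReal_le hCtop hX0 ?_
      rw [← hX]
      refine le_trans ?_ ((lTwo_lintegral_le hη (muPhase d₁ d₂) k hfm).trans
        (mul_le_mul_left le_add_self _))
      rw [ofReal_sqrt, lTwo, lintegral_count]
      gcongr
      refine (ofReal_tsum_le fun n => sq_nonneg _).trans (ENNReal.tsum_le_tsum fun n => ?_)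
      rw [ENNReal.ofReal_pow (integral_nonneg fun τ => norm_nonneg _)]
      gcongr
      refine (ofReal_integral_le fun τ => norm_nonneg _).trans (lintegral_mono fun τ => ?_)
      rw [ofReal_norm]
  · intro γ
    obtain ⟨Cγ, hCγ, hker⟩ := exists_fourierIntegral_kerL γ
    set C : ℝ≥0∞ := ENNReal.ofReal Cγ * (8 * kerMass * geomSum + 2048 * geomSum) with hC
    have hkm := kerMass_lt_top.ne
    have hgs := geomSum_lt_top.ne
    have hCtop : C ≠ ∞ := by
      simp only [hC]
      finiteness
    refine ⟨C.toReal + 1, by positivity, fun d₁ d₂ k l hl t₀ f hsupp hf => ?_⟩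
    have hfm : ∀ n, Measurable fun τ => f τ n := fun n => hf.1.comp measurable_prodMk_right
    have hTm : ∀ n, Measurable (convK (kerL l) fun τ' => ‖f τ' n‖ₑ) := fun n =>
      measurable_convK (measurable_kerL l) (hfm n).enorm
    have hX := xNorm_enorm_eq hη hsupp hf
    have hfi : ∀ n, ∫⁻ τ, ‖f τ n‖ₑ < ∞ := fun n => by
      have h1 := lTwo_lintegral_le hη (muPhase d₁ d₂) k fun n => (hfm n).enorm
      rw [hX] at h1
      have h2 : (∫⁻ τ, ‖f τ n‖ₑ) ^ 2 ≤ lTwo Measure.count (fun n => ∫⁻ τ, ‖f τ n‖ₑ) ^ 2 := by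
        rw [lTwo_sq, lintegral_count]
        exact ENNReal.le_tsum n
      exact ((ENNReal.pow_le_pow_left_iff two_ne_zero).1 h2 |>.trans h1).trans_lt (by finiteness)
    have hgi : Integrable fun t : ℝ => γ ((2 : ℝ) ^ l * (t - t₀)) :=
      ((γ.integrable (μ := volume)).comp_mul_left' (R := (2 : ℝ) ^ l)
        (by positivity)).comp_sub_right t₀
    refine le_mul_of_ofReal_le hCtop (Xnorm_nonneg d₁ d₂ k f) ?_
    rw [← hX, hC, mul_assoc]
    refine (ofReal_Xnorm_le hη d₁ d₂ k (fun n => (hTm n).const_mul _) fun τ n =>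
      enorm_timeFT_mul_timeIFT_le (hfm n) (hfi n) hgi (measurable_kerL l) (hker l t₀) τ).trans ?_
    rw [xNorm_const_mul hη _ _ _ hTm]
    exact mul_le_mul_right (xNorm_convK_le hη _ hl fun n => (hfm n).enorm) _

end MKdV5
end
end

section
/- There is a universal constant C such that for all integers k_i, j_i ≥ 0 (i = 1,2,3,4) and all nonnegative functions f_i ∈ L²(ℝ×ℤ) supported in D_{k_i,j_i}, one has J(f₁,f₂,f₃,f₄) ≤ C · 2^{(j_min+j_thd)/2} · 2^{(k_min+k_thd)/2} · Π_{i=1}^4 ‖f_i‖_{L²}. -/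
noncomputable section

open scoped BigOperators ComplexConjugate
open MeasureTheory Complex Set

namespace MKdV5

open scoped ENNReal

section QuadForm

variable {G : Type*} [MeasurableSpace G]

/-- The `L²` norm of an extended nonnegative function. -/
def l2E (μ : Measure G) (f : G → ℝ≥0∞) : ℝ≥0∞ := (∫⁻ x, f x ^ (2 : ℝ) ∂μ) ^ (1 / 2 : ℝ)

theorem l2E_sq (μ : Measure G) (f : G → ℝ≥0∞) :
    l2E μ f ^ (2 : ℝ) = ∫⁻ x, f x ^ (2 : ℝ) ∂μ := by
  rw [l2E, ← ENNReal.rpow_mul]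
  norm_num

/-- The Cauchy–Schwarz inequality. -/
theorem lintegral_mul_le_l2E (μ : Measure G) {f g : G → ℝ≥0∞} (hf : Measurable f)
    (hg : Measurable g) : ∫⁻ x, f x * g x ∂μ ≤ l2E μ f * l2E μ g :=
  ENNReal.lintegral_mul_le_Lp_mul_Lq μ Real.HolderConjugate.two_two
    hf.aemeasurable hg.aemeasurable

theorem lintegral_le_rpow_mul_l2E (μ : Measure G) {f : G → ℝ≥0∞} (hf : Measurable f) {s : Set G}
    (hs : MeasurableSet s) (hfs : ∀ x, f x ≠ 0 → x ∈ s) :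
    ∫⁻ x, f x ∂μ ≤ μ s ^ (1 / 2 : ℝ) * l2E μ f := by
  have h1 : ∀ x, f x = s.indicator 1 x * f x := by
    intro x
    by_cases hx : x ∈ s
    · simp [hx]
    · simp [hx, not_not.1 (mt (hfs x) hx)]
  have h2 : l2E μ (s.indicator 1) = μ s ^ (1 / 2 : ℝ) := by
    rw [l2E, ← lintegral_indicator_one hs]
    congr 2 with x
    by_cases hx : x ∈ s <;> simp [hx]
  calc ∫⁻ x, f x ∂μ = ∫⁻ x, s.indicator 1 x * f x ∂μ := lintegral_congr h1
    _ ≤ l2E μ (s.indicator 1) * l2E μ f :=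
      lintegral_mul_le_l2E μ (measurable_one.indicator hs) hf
    _ = _ := by rw [h2]

variable [AddCommGroup G]

/-- The quadrilinear convolution form `∫∫∫ f(x) g(y) h(z) k(x+y+z)`. -/
def quadForm (μ : Measure G) (f g h k : G → ℝ≥0∞) : ℝ≥0∞ :=
  ∫⁻ x, ∫⁻ y, ∫⁻ z, f x * g y * h z * k (x + y + z) ∂μ ∂μ ∂μ

variable [MeasurableAdd₂ G] (μ : Measure G) {f g h k : G → ℝ≥0∞}

theorem l2E_add_left [μ.IsAddLeftInvariant] (f : G → ℝ≥0∞) (a : G) :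
    l2E μ (fun x => f (a + x)) = l2E μ f := by
  rw [l2E, l2E, lintegral_add_left_eq_self (fun x => f x ^ (2 : ℝ)) a]

theorem quadForm_swap₁₂ [SFinite μ] (hf : Measurable f) (hg : Measurable g) (hh : Measurable h)
    (hk : Measurable k) : quadForm μ f g h k = quadForm μ g f h k := by
  rw [quadForm, lintegral_lintegral_swap
    (Measurable.lintegral_prod_right' (f := fun q : (G × G) × G =>
      f q.1.1 * g q.1.2 * h q.2 * k (q.1.1 + q.1.2 + q.2)) (by fun_prop)).aemeasurable]
  simp only [quadForm, mul_comm (f _) (g _), add_comm]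

theorem quadForm_swap₂₃ [SFinite μ] (hg : Measurable g) (hh : Measurable h)
    (hk : Measurable k) : quadForm μ f g h k = quadForm μ f h g k := by
  refine lintegral_congr fun x => ?_
  rw [lintegral_lintegral_swap (by fun_prop)]
  simp only [mul_right_comm (f x) (g _) (h _), add_right_comm x]

theorem quadForm_le₁₂ [SFinite μ] [μ.IsAddLeftInvariant] (hf : Measurable f) (hg : Measurable g)
    (hh : Measurable h) (hk : Measurable k) :
    quadForm μ f g h k ≤ (∫⁻ x, f x ∂μ) * (∫⁻ x, g x ∂μ) * l2E μ h * l2E μ k := by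
  calc quadForm μ f g h k
      ≤ ∫⁻ x, ∫⁻ y, f x * g y * (l2E μ h * l2E μ k) ∂μ ∂μ := by
        refine lintegral_mono fun x => lintegral_mono fun y => ?_
        simp only [mul_assoc (f x * g y)]
        rw [lintegral_const_mul _ (by fun_prop), ← l2E_add_left μ k (x + y)]
        gcongr
        exact lintegral_mul_le_l2E μ hh (by fun_prop)
    _ = _ := by
        simp only [mul_assoc (f _)]
        simp_rw [lintegral_const_mul _ (hg.mul_const _), lintegral_mul_const _ hg]
        rw [lintegral_mul_const _ hf]
        ring

variable [MeasurableNeg G]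

theorem l2E_sub_left [μ.IsAddLeftInvariant] [μ.IsNegInvariant] (f : G → ℝ≥0∞) (a : G) :
    l2E μ (fun x => f (a - x)) = l2E μ f := by
  rw [l2E, l2E, lintegral_sub_left_eq_self (fun x => f x ^ (2 : ℝ)) a]

theorem quadForm_le₁₄ [SFinite μ] [μ.IsAddLeftInvariant] [μ.IsNegInvariant] (hf : Measurable f)
    (hg : Measurable g) (hh : Measurable h) (hk : Measurable k) :
    quadForm μ f g h k ≤ (∫⁻ x, f x ∂μ) * (∫⁻ x, k x ∂μ) * l2E μ g * l2E μ h := by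
  have : quadForm μ f g h k = ∫⁻ x, ∫⁻ w, f x * k w * ∫⁻ y, g y * h (w - x - y) ∂μ ∂μ ∂μ := by
    refine lintegral_congr fun x => ?_
    calc _ = ∫⁻ y, ∫⁻ w, f x * g y * h (w - x - y) * k w ∂μ ∂μ := by
          refine lintegral_congr fun y => ?_
          rw [← lintegral_add_left_eq_self (fun w => f x * g y * h (w - x - y) * k w) (x + y)]
          refine lintegral_congr fun z => ?_
          rw [show x + y + z - x - y = z by abel]
      _ = _ := by
          rw [lintegral_lintegral_swap (by fun_prop)]
          refine lintegral_congr fun w => ?_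
          rw [← lintegral_const_mul _ (by fun_prop)]
          refine lintegral_congr fun y => ?_
          ring
  rw [this]
  calc _ ≤ ∫⁻ x, ∫⁻ w, f x * k w * (l2E μ g * l2E μ h) ∂μ ∂μ := by
        refine lintegral_mono fun x => lintegral_mono fun w => ?_
        dsimp only
        rw [← l2E_sub_left μ h (w - x)]
        gcongr
        exact lintegral_mul_le_l2E μ hg (by fun_prop)
    _ = _ := by
        simp only [mul_assoc (f _)]
        simp_rw [lintegral_const_mul _ (hk.mul_const _), lintegral_mul_const _ hk]
        rw [lintegral_mul_const _ hf]
        ring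

/-- If the `L¹` norm of each factor is at most `c 2^{jᵢ/2}` times its `L²` norm, then the
convolution form is controlled through the two smallest exponents. -/
theorem quadForm_le_of_lintegral_le [SFinite μ] [μ.IsAddLeftInvariant] [μ.IsNegInvariant]
    (hf : Measurable f) (hg : Measurable g) (hh : Measurable h) (hk : Measurable k)
    (c : ℝ≥0∞) (j₁ j₂ j₃ j₄ : ℕ)
    (hf1 : ∫⁻ x, f x ∂μ ≤ c * 2 ^ (j₁ / 2 : ℝ) * l2E μ f)
    (hg1 : ∫⁻ x, g x ∂μ ≤ c * 2 ^ (j₂ / 2 : ℝ) * l2E μ g)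
    (hh1 : ∫⁻ x, h x ∂μ ≤ c * 2 ^ (j₃ / 2 : ℝ) * l2E μ h)
    (hk1 : ∫⁻ x, k x ∂μ ≤ c * 2 ^ (j₄ / 2 : ℝ) * l2E μ k) :
    quadForm μ f g h k ≤
      c ^ 2 * 2 ^ (((min4 j₁ j₂ j₃ j₄ : ℝ) + (thd4 j₁ j₂ j₃ j₄ : ℝ)) / 2) *
        (l2E μ f * l2E μ g * l2E μ h * l2E μ k) := by
  have comb : ∀ {T : ℝ≥0∞} {I J A B C D : ℝ≥0∞} {a b : ℕ}, T ≤ I * J * C * D →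
      I ≤ c * 2 ^ (a / 2 : ℝ) * A → J ≤ c * 2 ^ (b / 2 : ℝ) * B →
      min4 j₁ j₂ j₃ j₄ + thd4 j₁ j₂ j₃ j₄ = a + b →
      T ≤ c ^ 2 * 2 ^ (((min4 j₁ j₂ j₃ j₄ : ℝ) + (thd4 j₁ j₂ j₃ j₄ : ℝ)) / 2) *
        (A * B * C * D) := by
    intro T I J A B C D a b hT hI hJ hab
    have hab' : (min4 j₁ j₂ j₃ j₄ : ℝ) + (thd4 j₁ j₂ j₃ j₄ : ℝ) = a + b := by exact_mod_cast hab
    rw [hab', add_div, ENNReal.rpow_add _ _ two_ne_zero ENNReal.ofNat_ne_top]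
    calc T ≤ I * J * C * D := hT
      _ ≤ (c * 2 ^ (a / 2 : ℝ) * A) * (c * 2 ^ (b / 2 : ℝ) * B) * C * D := by gcongr
      _ = _ := by ring
  have hpair : min4 j₁ j₂ j₃ j₄ + thd4 j₁ j₂ j₃ j₄ = j₁ + j₂ ∨
      min4 j₁ j₂ j₃ j₄ + thd4 j₁ j₂ j₃ j₄ = j₁ + j₃ ∨
      min4 j₁ j₂ j₃ j₄ + thd4 j₁ j₂ j₃ j₄ = j₂ + j₃ ∨
      min4 j₁ j₂ j₃ j₄ + thd4 j₁ j₂ j₃ j₄ = j₁ + j₄ ∨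
      min4 j₁ j₂ j₃ j₄ + thd4 j₁ j₂ j₃ j₄ = j₂ + j₄ ∨
      min4 j₁ j₂ j₃ j₄ + thd4 j₁ j₂ j₃ j₄ = j₃ + j₄ := by
    unfold min4 thd4
    omega
  rcases hpair with e | e | e | e | e | e
  · exact comb (quadForm_le₁₂ μ hf hg hh hk) hf1 hg1 e
  · rw [quadForm_swap₂₃ μ hg hh hk]
    exact (comb (quadForm_le₁₂ μ hf hh hg hk) hf1 hh1 e).trans_eq (by ring)
  · rw [quadForm_swap₁₂ μ hf hg hh hk, quadForm_swap₂₃ μ hf hh hk]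
    exact (comb (quadForm_le₁₂ μ hg hh hf hk) hg1 hh1 e).trans_eq (by ring)
  · exact (comb (quadForm_le₁₄ μ hf hg hh hk) hf1 hk1 e).trans_eq (by ring)
  · rw [quadForm_swap₁₂ μ hf hg hh hk]
    exact (comb (quadForm_le₁₄ μ hg hf hh hk) hg1 hk1 e).trans_eq (by ring)
  · rw [quadForm_swap₂₃ μ hg hh hk, quadForm_swap₁₂ μ hf hh hg hk]
    exact (comb (quadForm_le₁₄ μ hh hf hg hk) hh1 hk1 e).trans_eq (by ring)

end QuadForm

theorem abs_le_of_mem_IkR {k : ℕ} {x : ℝ} (hx : x ∈ IkR k) : |x| ≤ 2 ^ (k + 1) := by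
  unfold IkR at hx
  split_ifs at hx with hk
  · simpa [hk] using hx
  · exact hx.2

/-- The `L²` norm in the modulation variable at a fixed frequency. -/
def fiberNorm (f : ℝ → ℤ → ℝ) (n : ℤ) : ℝ≥0∞ := l2E volume fun τ => ‖f τ n‖ₑ

section Fiber

variable {d₁ d₂ : ℝ} {k j : ℕ} {f : ℝ → ℤ → ℝ}

theorem L2Finite.measurable_fiber (hf : L2Finite f) (n : ℤ) : Measurable fun τ => f τ n :=
  hf.1.comp measurable_prodMk_right

theorem rpow_half_mul_two_pow (a j : ℕ) :
    ((a : ℝ≥0∞) * 2 ^ j) ^ (1 / 2 : ℝ) = (a : ℝ≥0∞) ^ (1 / 2 : ℝ) * 2 ^ (j / 2 : ℝ) := by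
  rw [ENNReal.mul_rpow_of_nonneg _ _ (by norm_num), ← ENNReal.rpow_natCast 2 j, ← ENNReal.rpow_mul,
    mul_one_div]

theorem lintegral_enorm_le_of_InDkj (hf : L2Finite f) (hD : InDkj d₁ d₂ k j f) (n : ℤ) :
    ∫⁻ τ, ‖f τ n‖ₑ ≤ ((4 : ℕ) : ℝ≥0∞) ^ (1 / 2 : ℝ) * 2 ^ (j / 2 : ℝ) * fiberNorm f n := by
  have hs : ∀ τ, ‖f τ n‖ₑ ≠ 0 →
      τ ∈ Icc (muPhase d₁ d₂ n - 2 ^ (j + 1)) (muPhase d₁ d₂ n + 2 ^ (j + 1)) := by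
    intro τ hτ
    have := abs_le.1 (abs_le_of_mem_IkR (hD τ n (enorm_ne_zero.1 hτ)).2)
    constructor <;> linarith
  refine (lintegral_le_rpow_mul_l2E volume (hf.measurable_fiber n).enorm measurableSet_Icc
    hs).trans_eq ?_
  rw [Real.volume_Icc, ← rpow_half_mul_two_pow, fiberNorm,
    show muPhase d₁ d₂ n + 2 ^ (j + 1) - (muPhase d₁ d₂ n - 2 ^ (j + 1)) = (4 : ℕ) * 2 ^ j by
      push_cast; ring,
    ENNReal.ofReal_mul (by positivity), ENNReal.ofReal_natCast, ENNReal.ofReal_pow (by norm_num)]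
  norm_num

theorem exists_ne_zero_of_fiberNorm_ne_zero {n : ℤ} (h : fiberNorm f n ≠ 0) : ∃ τ, f τ n ≠ 0 := by
  by_contra! h0
  simp [fiberNorm, l2E, h0] at h

theorem InDkj.mem_Icc (hD : InDkj d₁ d₂ k j f) {τ : ℝ} {n : ℤ} (h : f τ n ≠ 0) :
    n ∈ Icc (-2 ^ (k + 1) : ℤ) (2 ^ (k + 1)) := by
  have := abs_le.1 (abs_le_of_mem_IkR (hD τ n h).1)
  exact ⟨by exact_mod_cast this.1, by exact_mod_cast this.2⟩

theorem lintegral_fiberNorm_le_of_InDkj (hD : InDkj d₁ d₂ k j f) :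
    ∫⁻ n, fiberNorm f n ∂Measure.count ≤
      ((8 : ℕ) : ℝ≥0∞) ^ (1 / 2 : ℝ) * 2 ^ (k / 2 : ℝ) * l2E Measure.count (fiberNorm f) := by
  have hs : ∀ n, fiberNorm f n ≠ 0 → n ∈ Icc (-2 ^ (k + 1) : ℤ) (2 ^ (k + 1)) := fun n hn =>
    let ⟨_, h⟩ := exists_ne_zero_of_fiberNorm_ne_zero hn
    hD.mem_Icc h
  refine (lintegral_le_rpow_mul_l2E Measure.count .of_discrete .of_discrete hs).trans ?_
  rw [← rpow_half_mul_two_pow, ← Finset.coe_Icc, Measure.count_apply_finset, Int.card_Icc]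
  gcongr
  have h1 : (2 ^ (k + 1) + 1 - -2 ^ (k + 1) : ℤ).toNat ≤ 8 * 2 ^ k := by
    have : (1 : ℤ) ≤ 2 ^ k := one_le_pow₀ (by norm_num)
    rw [Int.toNat_le]
    push_cast
    rw [pow_succ]
    linarith
  exact_mod_cast h1

theorem l2E_fiberNorm (hf : L2Finite f) (hD : InDkj d₁ d₂ k j f) :
    l2E Measure.count (fiberNorm f) = ENNReal.ofReal (l2R f) := by
  have hsum : ∀ τ, Summable fun n => f τ n ^ 2 := fun τ =>
    summable_of_hasFiniteSupport <| (finite_Icc (-2 ^ (k + 1) : ℤ) (2 ^ (k + 1))).subset fun n hn =>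
      hD.mem_Icc (τ := τ) fun h => hn (by simp [h])
  have hnn : ∀ τ, 0 ≤ ∑' n, f τ n ^ 2 := fun τ => tsum_nonneg fun n => sq_nonneg _
  rw [l2E, l2R, Real.sqrt_eq_rpow,
    ← ENNReal.ofReal_rpow_of_nonneg (integral_nonneg hnn) (by norm_num),
    ofReal_integral_eq_lintegral_ofReal hf.2 (.of_forall hnn), lintegral_count]
  simp only [fiberNorm, l2E_sq]
  rw [← lintegral_tsum fun n => ((hf.measurable_fiber n).enorm.pow_const _).aemeasurable]
  congr 2 with τ
  rw [ENNReal.ofReal_tsum_of_nonneg (fun n => sq_nonneg _) (hsum τ)]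
  refine tsum_congr fun n => ?_
  rw [← Real.enorm_of_nonneg (sq_nonneg _), enorm_pow]
  exact_mod_cast ENNReal.rpow_natCast _ 2

end Fiber

theorem enorm_Jfun_le (f₁ f₂ f₃ f₄ : ℝ → ℤ → ℝ) :
    ‖Jfun f₁ f₂ f₃ f₄‖ₑ ≤ ∑' p : ℤ × ℤ × ℤ, ∫⁻ ζ : ℝ × ℝ × ℝ,
      ‖f₁ ζ.1 p.1‖ₑ * ‖f₂ ζ.2.1 p.2.1‖ₑ * ‖f₃ ζ.2.2 p.2.2‖ₑ *
        ‖f₄ (ζ.1 + ζ.2.1 + ζ.2.2) (p.1 + p.2.1 + p.2.2)‖ₑ := by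
  set I : ℤ × ℤ × ℤ → ℤ → ℝ≥0∞ := fun p n => ∫⁻ ζ : ℝ × ℝ × ℝ,
    ‖f₁ ζ.1 p.1‖ₑ * ‖f₂ ζ.2.1 p.2.1‖ₑ * ‖f₃ ζ.2.2 p.2.2‖ₑ * ‖f₄ (ζ.1 + ζ.2.1 + ζ.2.2) n‖ₑ with hI
  calc ‖Jfun f₁ f₂ f₃ f₄‖ₑ
      ≤ ∑' n : ℤ, ∑' p : ℤ × ℤ × ℤ, if n = p.1 + p.2.1 + p.2.2 then I p n else 0 := by
        refine enorm_tsum_le_tsum_enorm.trans (ENNReal.tsum_le_tsum fun n =>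
          enorm_tsum_le_tsum_enorm.trans (ENNReal.tsum_le_tsum fun p => ?_))
        split_ifs with h1 h2 h2
        · refine (enorm_integral_le_lintegral_enorm _).trans_eq ?_
          simp only [enorm_mul, hI]
        · exact absurd h1.1.symm h2
        · simp
        · simp
    _ = ∑' p : ℤ × ℤ × ℤ, I p (p.1 + p.2.1 + p.2.2) := by
        rw [ENNReal.tsum_comm]
        exact tsum_congr fun p => tsum_ite_eq _ _

theorem enorm_Jfun_le_quadForm {d₁ d₂ : ℝ} {k₁ k₂ k₃ k₄ j₁ j₂ j₃ j₄ : ℕ} {f₁ f₂ f₃ f₄ : ℝ → ℤ → ℝ}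
    (hf₁ : L2Finite f₁) (hf₂ : L2Finite f₂) (hf₃ : L2Finite f₃) (hf₄ : L2Finite f₄)
    (hD₁ : InDkj d₁ d₂ k₁ j₁ f₁) (hD₂ : InDkj d₁ d₂ k₂ j₂ f₂)
    (hD₃ : InDkj d₁ d₂ k₃ j₃ f₃) (hD₄ : InDkj d₁ d₂ k₄ j₄ f₄) :
    ‖Jfun f₁ f₂ f₃ f₄‖ₑ ≤
      (((4 : ℕ) : ℝ≥0∞) ^ (1 / 2 : ℝ)) ^ 2 *
        2 ^ (((min4 j₁ j₂ j₃ j₄ : ℝ) + (thd4 j₁ j₂ j₃ j₄ : ℝ)) / 2) *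
        quadForm Measure.count (fiberNorm f₁) (fiberNorm f₂) (fiberNorm f₃) (fiberNorm f₄) := by
  refine (enorm_Jfun_le f₁ f₂ f₃ f₄).trans ?_
  simp only [quadForm, lintegral_count, ← ENNReal.tsum_mul_left]
  rw [ENNReal.tsum_prod']
  refine ENNReal.tsum_le_tsum fun a => ?_
  rw [ENNReal.tsum_prod']
  refine ENNReal.tsum_le_tsum fun b => ENNReal.tsum_le_tsum fun c => ?_
  have m₁ := (hf₁.measurable_fiber a).enorm
  have m₂ := (hf₂.measurable_fiber b).enorm
  have m₃ := (hf₃.measurable_fiber c).enorm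
  have m₄ := (hf₄.measurable_fiber (a + b + c)).enorm
  have hm : Measurable fun ζ : ℝ × ℝ × ℝ => ‖f₁ ζ.1 a‖ₑ * ‖f₂ ζ.2.1 b‖ₑ * ‖f₃ ζ.2.2 c‖ₑ *
      ‖f₄ (ζ.1 + ζ.2.1 + ζ.2.2) (a + b + c)‖ₑ :=
    (((m₁.comp measurable_fst).mul (m₂.comp measurable_snd.fst)).mul
      (m₃.comp measurable_snd.snd)).mul (m₄.comp (by fun_prop))
  have hform : ∫⁻ ζ : ℝ × ℝ × ℝ, ‖f₁ ζ.1 a‖ₑ * ‖f₂ ζ.2.1 b‖ₑ * ‖f₃ ζ.2.2 c‖ₑ *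
      ‖f₄ (ζ.1 + ζ.2.1 + ζ.2.2) (a + b + c)‖ₑ =
      quadForm volume (fun τ => ‖f₁ τ a‖ₑ) (fun τ => ‖f₂ τ b‖ₑ) (fun τ => ‖f₃ τ c‖ₑ)
        (fun τ => ‖f₄ τ (a + b + c)‖ₑ) := by
    rw [Measure.volume_eq_prod, lintegral_prod _ hm.aemeasurable]
    refine lintegral_congr fun x => ?_
    exact lintegral_prod _ (hm.comp measurable_prodMk_left).aemeasurable
  rw [hform]
  exact quadForm_le_of_lintegral_le volume m₁ m₂ m₃ m₄ _ j₁ j₂ j₃ j₄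
    (lintegral_enorm_le_of_InDkj hf₁ hD₁ a) (lintegral_enorm_le_of_InDkj hf₂ hD₂ b)
    (lintegral_enorm_le_of_InDkj hf₃ hD₃ c) (lintegral_enorm_le_of_InDkj hf₄ hD₄ _)

/-- **Block estimate (a)** (Lemma 4.1(a)): for `f_i` supported in `D_{k_i,j_i}`,
`J(f₁,f₂,f₃,f₄) ≲ 2^{(j_min+j_thd)/2} 2^{(k_min+k_thd)/2} Π‖f_i‖_{L²}`. -/
theorem block_estimate_a (d₁ d₂ : ℝ) :
    ∃ C > (0:ℝ), ∀ k₁ k₂ k₃ k₄ j₁ j₂ j₃ j₄ : ℕ, ∀ f₁ f₂ f₃ f₄ : ℝ → ℤ → ℝ,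
      (∀ τ n, 0 ≤ f₁ τ n) → (∀ τ n, 0 ≤ f₂ τ n) → (∀ τ n, 0 ≤ f₃ τ n) → (∀ τ n, 0 ≤ f₄ τ n) →
      L2Finite f₁ → L2Finite f₂ → L2Finite f₃ → L2Finite f₄ →
      InDkj d₁ d₂ k₁ j₁ f₁ → InDkj d₁ d₂ k₂ j₂ f₂ →
      InDkj d₁ d₂ k₃ j₃ f₃ → InDkj d₁ d₂ k₄ j₄ f₄ →
      Jfun f₁ f₂ f₃ f₄ ≤
        C * (2 : ℝ) ^ (((min4 j₁ j₂ j₃ j₄ : ℝ) + (thd4 j₁ j₂ j₃ j₄ : ℝ)) / 2) *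
          (2 : ℝ) ^ (((min4 k₁ k₂ k₃ k₄ : ℝ) + (thd4 k₁ k₂ k₃ k₄ : ℝ)) / 2) *
          (l2R f₁ * l2R f₂ * l2R f₃ * l2R f₄) := by
  refine ⟨32, by norm_num, ?_⟩
  intro k₁ k₂ k₃ k₄ j₁ j₂ j₃ j₄ f₁ f₂ f₃ f₄ _ _ _ _ hf₁ hf₂ hf₃ hf₄ hD₁ hD₂ hD₃ hD₄
  have hJ := enorm_Jfun_le_quadForm hf₁ hf₂ hf₃ hf₄ hD₁ hD₂ hD₃ hD₄
  have hQ := quadForm_le_of_lintegral_le Measure.count (f := fiberNorm f₁) (g := fiberNorm f₂)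
    (h := fiberNorm f₃) (k := fiberNorm f₄) .of_discrete .of_discrete .of_discrete .of_discrete
    _ k₁ k₂ k₃ k₄ (lintegral_fiberNorm_le_of_InDkj hD₁) (lintegral_fiberNorm_le_of_InDkj hD₂)
    (lintegral_fiberNorm_le_of_InDkj hD₃) (lintegral_fiberNorm_le_of_InDkj hD₄)
  rw [l2E_fiberNorm hf₁ hD₁, l2E_fiberNorm hf₂ hD₂, l2E_fiberNorm hf₃ hD₃,
    l2E_fiberNorm hf₄ hD₄] at hQ
  have hsq : ∀ a : ℕ, ((a : ENNReal) ^ (1 / 2 : ℝ)) ^ 2 = a := fun a => by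
    rw [← ENNReal.rpow_natCast, ← ENNReal.rpow_mul]
    norm_num
  have hpow : ∀ s : ℝ, (2 : ENNReal) ^ s = ENNReal.ofReal ((2 : ℝ) ^ s) := fun s => by
    rw [← ENNReal.ofReal_rpow_of_pos two_pos, ENNReal.ofReal_ofNat]
  have hl : ∀ f : ℝ → ℤ → ℝ, 0 ≤ l2R f := fun f => Real.sqrt_nonneg _
  have h1 := hl f₁
  have h2 := hl f₂
  have h3 := hl f₃
  have h4 := hl f₄
  have key := hJ.trans (mul_le_mul_right hQ _)
  simp only [hsq, hpow] at key
  simp only [← ENNReal.ofReal_natCast] at key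
  rw [← ENNReal.ofReal_mul (by positivity), ← ENNReal.ofReal_mul (by positivity),
    ← ENNReal.ofReal_mul (by positivity), ← ENNReal.ofReal_mul (by positivity),
    ← ENNReal.ofReal_mul (by positivity), ← ENNReal.ofReal_mul (by positivity),
    ← ENNReal.ofReal_mul (by positivity), Real.enorm_eq_ofReal_abs,
    ENNReal.ofReal_le_ofReal_iff (by positivity)] at key
  refine (le_abs_self _).trans (key.trans_eq ?_)
  push_cast
  ring

end MKdV5
end
end
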